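/- Fix an integer s < 0 and let ν_d(s) denote the t-adic valuation of S_d(s). Then ν_d(s) > ν_{d−1}(s) for every integer d with 2 ≤ d ≤ ⌊L_{−s}⌋, and if L_{−s} ≥ 1 then ν_1(s) ≥ ν_0(s) = 0. -/

import Mathlib

open Polynomial

/-- The power sum `S_d(-k) = ∑_{a monic, deg a = d} a^k`, written as a sum over the
lower-order coefficients of the monic polynomial. -/
noncomputable def powerSum (Fq : Type) [Field Fq] [Fintype Fq] (d k : ℕ) : Polynomial Fq :=
  ∑ c : Fin d → Fq, (X ^ d + ∑ i : Fin d, C (c i) * X ^ (i : ℕ)) ^ k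

/-- `m` sums to `k` with no carrying of digits in base `p`. -/
def NoCarry (p : ℕ) {n : ℕ} (m : Fin n → ℕ) (k : ℕ) : Prop :=
  (∑ i, m i) = k ∧ ∀ j : ℕ, (∑ i, m i / p ^ j % p) = k / p ^ j % p

/-- The set `U_d(k)`. -/
def Uset (p q d k : ℕ) : Set (Fin (d + 1) → ℕ) :=
  {m | NoCarry p m k ∧ ∀ i : Fin (d + 1), 0 < (i : ℕ) → 0 < m i ∧ (q - 1) ∣ m i}

/-- The weight of an element of `U_d(k)`. -/
def wtU {d : ℕ} (m : Fin (d + 1) → ℕ) : ℕ :=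
  ∑ i : Fin (d + 1), (d - (i : ℕ)) * m i

/-- Strict lexicographic order on tuples. -/
def LexLT {n : ℕ} (x y : Fin n → ℕ) : Prop :=
  ∃ i, (∀ j, j < i → x j = y j) ∧ x i < y i

/-- Lexicographic order on tuples. -/
def LexLE {n : ℕ} (x y : Fin n → ℕ) : Prop := x = y ∨ LexLT x y

/-- `L_k := min_{0 ≤ i < f} l(k p^i)/(q-1)` where `l` is the base-`q` digit sum, `q = p^f`. -/
noncomputable def Lval (p f k : ℕ) (hf : 0 < f) : ℚ :=
  (Finset.range f).inf' ⟨0, Finset.mem_range.mpr hf⟩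
    (fun i => ((Nat.digits (p ^ f) (k * p ^ i)).sum : ℚ) / ((p : ℚ) ^ f - 1))

/-- The set `W_d(N)` of compositions. -/
def Wset (p q d N : ℕ) : Set (Fin d → ℕ) :=
  {Y | NoCarry p Y N ∧ ∀ i : Fin d, (i : ℕ) + 1 < d → 0 < Y i ∧ (q - 1) ∣ Y i}

/-- The weight of a composition. -/
def wtW {d : ℕ} (Y : Fin d → ℕ) : ℕ := ∑ i : Fin d, ((i : ℕ) + 1) * Y i

/-- `X` is the modest (lexicographically largest) composition in `W_d(N)`. -/
def Modest (p q : ℕ) {d : ℕ} (N : ℕ) (X : Fin d → ℕ) : Prop :=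
  X ∈ Wset p q d N ∧ ∀ Y ∈ Wset p q d N, LexLE Y X

/-- `X` is an optimal (minimum weight) composition in `W_d(N)`. -/
def Optimal (p q : ℕ) {d : ℕ} (N : ℕ) (X : Fin d → ℕ) : Prop :=
  X ∈ Wset p q d N ∧ ∀ Y ∈ Wset p q d N, wtW X ≤ wtW Y

/-- `Γ(n) : Fin f → ℕ`, summing the base-`p` digits of `n` in each residue class mod `f`. -/
def Gamma (p f n : ℕ) : Fin f → ℕ :=
  fun i => ∑ j ∈ Finset.range (Nat.log p n + 1), if j % f = (i : ℕ) then n / p ^ j % p else 0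

/-- The cyclic matrix `E`, as a map: `(E x)_i = p x_{i+1} - x_i`, indices mod `f`. -/
def Emap (p : ℕ) {R : Type} [Ring R] {f : ℕ} (x : Fin f → R) : Fin f → R :=
  fun i => (p : R) * x ⟨((i : ℕ) + 1) % f, Nat.mod_lt _ i.pos⟩ - x i

/-- `𝔍 = {Γ(n) : n > 0 is q-even}`, where `q = p ^ f`. -/
def Jfrak (p f : ℕ) : Set (Fin f → ℕ) :=
  {w | ∃ n : ℕ, 0 < n ∧ (p ^ f - 1) ∣ n ∧ Gamma p f n = w}

/-- `I_d`. -/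
def Iset (p f d : ℕ) : Set (Fin f → ℕ) :=
  {u | (∃ n : ℕ, 0 < n ∧ Gamma p f n = u) ∧
    ∃ v : Fin (d - 1) → Fin f → ℕ, (∀ j, v j ∈ Jfrak p f) ∧ (∑ j, v j) < u}

/-- `J_d`. -/
def Jset (p f d : ℕ) : Set (Fin f → ℕ) :=
  if d = 0 then ∅ else Jfrak p f ∩ (Iset p f d \ Iset p f (d + 1))

/-- A composition is `τ`-monotonic. -/
def TauMonotonic (p f : ℕ) {d : ℕ} (X : Fin d → ℕ) : Prop :=
  ∀ i j : Fin d, i < j → ∀ m n : ℕ, X i / p ^ m % p ≠ 0 → X j / p ^ n % p ≠ 0 →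
    m % f = n % f → n ≤ m

/-- `W_d^B(N)`: compositions in `W_d(N)` whose `Γ`-matrix is `B`. -/
def WBset (p f d N : ℕ) (B : Fin d → Fin f → ℕ) : Set (Fin d → ℕ) :=
  {Y | Y ∈ Wset p (p ^ f) d N ∧ ∀ j, Gamma p f (Y j) = B j}

/-- The multizeta value `ζ(-k_1, …, -k_r)` as a (finite) sum over strictly
decreasing tuples of degrees. -/
noncomputable def multizeta (Fq : Type) [Field Fq] [Fintype Fq] {r : ℕ} (k : Fin r → ℕ) :
    Polynomial Fq :=
  ∑ᶠ (dt : Fin r → ℕ) (_ : StrictAnti dt), ∏ i, powerSum Fq (dt i) (k i)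

set_option linter.unusedSectionVars false
namespace PS

variable {f : ℕ} [NeZero f]

theorem cyc_ind (Q : ZMod f → Prop) (m : ZMod f) (h0 : Q m) (hs : ∀ m, Q m → Q (m + 1)) :
    ∀ m', Q m' := by
  have key : ∀ s : ℕ, Q (m + s) := by
    intro s
    induction s with
    | zero => simpa using h0
    | succ s ih => have := hs _ ih; push_cast; rwa [← add_assoc]
  intro m'
  have := key (m' - m).val
  rwa [ZMod.natCast_zmod_val, add_sub_cancel] at this

/-- the number of digits of class `m` that are left over -/
def nn (p : ℕ) (l x : ZMod f → ℤ) (m : ZMod f) : ℤ := l m + x m - p * x (m + 1)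

def Feas (p : ℕ) (l x : ZMod f → ℤ) : Prop := ∀ m, 0 ≤ nn p l x m ∧ nn p l x m ≤ l m

def Vv (p : ℕ) (P : ZMod f → ℕ → ℕ) (m : ZMod f) (n : ℤ) : ℕ :=
  ∑ t ∈ Finset.range n.toNat, p ^ P m t

def cost (p : ℕ) (l : ZMod f → ℤ) (P : ZMod f → ℕ → ℕ) (x : ZMod f → ℤ) : ℕ :=
  ∑ m, Vv p P m (nn p l x m)

def IsCh (p : ℕ) (l : ZMod f → ℤ) : (ZMod f → ℤ) → List (ZMod f → ℤ) → Prop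
  | _, [] => True
  | b, x :: zs => Feas p l x ∧ (∀ m, b m ≤ x m) ∧ IsCh p l (fun m => x m + 1) zs

def MonoN (p : ℕ) (l : ZMod f → ℤ) : (ZMod f → ℤ) → List (ZMod f → ℤ) → Prop
  | _, [] => True
  | x, z :: zs => (∀ m, nn p l z m ≤ nn p l x m) ∧ MonoN p l z zs

def ccost (p : ℕ) (l : ZMod f → ℤ) (P : ZMod f → ℕ → ℕ) (zs : List (ZMod f → ℤ)) : ℕ :=
  (zs.map (cost p l P)).sum

/-- Properties of the digit positions. -/
structure Good (p : ℕ) (P : ZMod f → ℕ → ℕ) : Prop where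
  two : 2 ≤ p
  mono : ∀ m, Monotone (P m)
  mult : ∀ m t, P m t < P m (t + (p - 1))
  cls : ∀ m m' t t', P m t = P m' t' → m = m'

theorem pos_of_le (p : ℕ) (hp : 2 ≤ p) (u : ZMod f → ℤ) (h : ∀ m, u m ≤ p * u (m + 1)) :
    ∀ m, 0 ≤ u m := by
  obtain ⟨m0, -, hm0⟩ := Finset.exists_min_image Finset.univ u ⟨0, Finset.mem_univ _⟩
  have h1 := h (m0 - 1)
  rw [sub_add_cancel] at h1
  have h2 := hm0 (m0 - 1) (Finset.mem_univ _)
  have hp' : (2 : ℤ) ≤ p := by exact_mod_cast hp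
  intro m
  have h3 := hm0 m (Finset.mem_univ _)
  nlinarith

theorem one_le_of (p : ℕ) (hp : 2 ≤ p) (u : ZMod f → ℤ) (h : ∀ m, u m ≤ p * u (m + 1))
    (m0 : ZMod f) (hm0 : u m0 ≠ 0) : ∀ m, 1 ≤ u m := by
  have h0 := pos_of_le p hp u h
  refine cyc_ind (fun m => 1 ≤ u m) m0 ?_ ?_
  · have := h0 m0; show 1 ≤ u m0; omega
  · intro m hm
    show 1 ≤ u (m + 1)
    have h1 := h m
    have h2 := h0 (m + 1)
    have hm' : 1 ≤ u m := hm
    by_contra hc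
    have : u (m + 1) = 0 := by omega
    rw [this] at h1; omega

theorem nn_inj (p : ℕ) (hp : 2 ≤ p) (l x y : ZMod f → ℤ) (h : ∀ m, nn p l x m = nn p l y m) :
    x = y := by
  have h1 := pos_of_le p hp (fun m => x m - y m) (fun m => by
    have := h m; simp only [nn] at this; linarith)
  have h2 := pos_of_le p hp (fun m => y m - x m) (fun m => by
    have := h m; simp only [nn] at this; linarith)
  funext m
  have a1 : 0 ≤ x m - y m := h1 m
  have a2 : 0 ≤ y m - x m := h2 m
  omega

theorem Vv_conv (p : ℕ) (P : ZMod f → ℕ → ℕ) (hG : Good p P) (m : ZMod f) (lo hi a b : ℤ)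
    (h0 : 0 ≤ lo) (h1 : lo ≤ a) (h2 : a ≤ hi) (h3 : a + b = lo + hi) :
    Vv p P m a + Vv p P m b ≤ Vv p P m lo + Vv p P m hi := by
  obtain ⟨lo, rfl⟩ := Int.eq_ofNat_of_zero_le h0
  obtain ⟨s, hs⟩ := Int.eq_ofNat_of_zero_le (sub_nonneg.mpr h1)
  have hb : (lo : ℤ) ≤ b := by omega
  obtain ⟨b, rfl⟩ := Int.eq_ofNat_of_zero_le (h0.trans hb)
  have ha : a = ((lo + s : ℕ) : ℤ) := by push_cast; omega
  have hh : hi = ((b + s : ℕ) : ℤ) := by push_cast; omega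
  subst ha hh
  simp only [Vv, Int.toNat_natCast, Finset.sum_range_add]
  have : ∑ x ∈ Finset.range s, p ^ P m (lo + x) ≤ ∑ x ∈ Finset.range s, p ^ P m (b + x) := by
    refine Finset.sum_le_sum fun x _ => Nat.pow_le_pow_right (by have := hG.two; omega) ?_
    exact hG.mono m (by omega)
  omega

theorem Vv_mono (p : ℕ) (P : ZMod f → ℕ → ℕ) (m : ZMod f) {a b : ℤ} (h : a ≤ b) :
    Vv p P m a ≤ Vv p P m b := by
  refine Finset.sum_le_sum_of_subset (Finset.range_mono (Int.toNat_le_toNat h))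

theorem Vv_succ (p : ℕ) (P : ZMod f → ℕ → ℕ) (m : ZMod f) {a : ℤ} (h : 0 ≤ a) :
    Vv p P m (a + 1) = Vv p P m a + p ^ P m a.toNat := by
  obtain ⟨a, rfl⟩ := Int.eq_ofNat_of_zero_le h
  have : ((a : ℤ) + 1).toNat = a + 1 := by omega
  simp [Vv, this, Finset.sum_range_succ]

/-- sums of digits below `e`, each position with multiplicity at most `p - 1` -/
theorem sum_lt (p : ℕ) (P : ZMod f → ℕ → ℕ) (hG : Good p P) (A : Finset (Σ _ : ZMod f, ℕ)) (e : ℕ)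
    (hA : ∀ a ∈ A, P a.1 a.2 < e) : ∑ a ∈ A, p ^ P a.1 a.2 < p ^ e := by
  have hp := hG.two
  have h1 : ∑ a ∈ A, p ^ P a.1 a.2
      = ∑ j ∈ Finset.range e, ∑ a ∈ A with P a.1 a.2 = j, p ^ P a.1 a.2 :=
    (Finset.sum_fiberwise_of_maps_to (fun a ha => Finset.mem_range.mpr (hA a ha)) _).symm
  have h2 : ∀ j ∈ Finset.range e, ∑ a ∈ A with P a.1 a.2 = j, p ^ P a.1 a.2 ≤ (p - 1) * p ^ j := by
    intro j _
    have : ∑ a ∈ A with P a.1 a.2 = j, p ^ P a.1 a.2 = ∑ a ∈ A with P a.1 a.2 = j, p ^ j :=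
      Finset.sum_congr rfl fun a ha => by rw [(Finset.mem_filter.mp ha).2]
    rw [this, Finset.sum_const, smul_eq_mul]
    refine Nat.mul_le_mul_right _ ?_
    rcases (A.filter fun a => P a.1 a.2 = j).eq_empty_or_nonempty with h | h
    · simp [h]
    obtain ⟨a0, ha0, hmin⟩ := Finset.exists_min_image _ (fun a => a.2) h
    have hc : (A.filter fun a => P a.1 a.2 = j).card ≤ (Finset.Ico a0.2 (a0.2 + (p - 1))).card := by
      refine Finset.card_le_card_of_injOn (fun a => a.2) ?_ ?_
      · intro a ha
        have ha' : a ∈ A.filter fun a => P a.1 a.2 = j := ha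
        have h5 := hmin a ha'
        have h6 := (Finset.mem_filter.mp ha').2
        have h7 := (Finset.mem_filter.mp ha0).2
        have h8 : a.1 = a0.1 := hG.cls _ _ _ _ (h6.trans h7.symm)
        simp only [Finset.coe_Ico, Set.mem_Ico]
        refine ⟨h5, ?_⟩
        by_contra hc
        have h9 := hG.mult a0.1 a0.2
        have h10 := hG.mono a0.1 (not_lt.mp hc)
        rw [h8] at h6
        omega
      · intro a ha b hb hab
        have h6 := (Finset.mem_filter.mp (Finset.mem_coe.mp ha)).2
        have h7 := (Finset.mem_filter.mp (Finset.mem_coe.mp hb)).2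
        have h8 : a.1 = b.1 := hG.cls _ _ _ _ (h6.trans h7.symm)
        exact Sigma.ext h8 (heq_of_eq hab)
    simpa using hc
  have h3 : ∑ j ∈ Finset.range e, (p - 1) * p ^ j < p ^ e := by
    rw [← Finset.mul_sum, mul_comm]
    have := Nat.geomSum_eq hp e
    have h4 := Nat.div_mul_le_self (p ^ e - 1) (p - 1)
    rw [this]
    have : 0 < p ^ e := by positivity
    omega
  rw [h1]
  exact (Finset.sum_le_sum h2).trans_lt h3

/-- digits used by `y` and not by `x` -/
def Uu (p : ℕ) (l x y : ZMod f → ℤ) : Finset (Σ _ : ZMod f, ℕ) :=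
  Finset.univ.sigma fun m => Finset.Ico (nn p l x m).toNat (nn p l y m).toNat

theorem cost_Uu (p : ℕ) (l : ZMod f → ℤ) (P : ZMod f → ℕ → ℕ) (x y : ZMod f → ℤ) :
    cost p l P x + ∑ a ∈ Uu p l x y, p ^ P a.1 a.2
      = cost p l P y + ∑ a ∈ Uu p l y x, p ^ P a.1 a.2 := by
  simp only [cost, Uu, Finset.sum_sigma, ← Finset.sum_add_distrib]
  refine Finset.sum_congr rfl fun m _ => ?_
  simp only [Vv]
  rcases le_total (nn p l x m).toNat (nn p l y m).toNat with h | h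
  · rw [Finset.sum_range_add_sum_Ico _ h, Finset.Ico_eq_empty_of_le h]; simp
  · rw [Finset.sum_range_add_sum_Ico _ h, Finset.Ico_eq_empty_of_le h]; simp

theorem cost_dom (p : ℕ) (l : ZMod f → ℤ) (P : ZMod f → ℕ → ℕ) (hG : Good p P) (x y : ZMod f → ℤ)
    (a : Σ _ : ZMod f, ℕ) (ha : a ∈ Uu p l x y)
    (h : ∀ b ∈ Uu p l y x, P b.1 b.2 ≤ P a.1 a.2) : cost p l P x < cost p l P y := by
  have h1 := cost_Uu p l P x y
  have h2 : ∑ b ∈ Uu p l y x, p ^ P b.1 b.2 < p ^ P a.1 a.2 := by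
    refine sum_lt p P hG _ _ fun b hb => lt_of_le_of_ne (h b hb) fun hc => ?_
    have := hG.cls _ _ _ _ hc
    simp only [Uu, Finset.mem_sigma, Finset.mem_univ, true_and, Finset.mem_Ico] at ha hb
    rw [this] at hb
    omega
  have h3 : p ^ P a.1 a.2 ≤ ∑ b ∈ Uu p l x y, p ^ P b.1 b.2 :=
    Finset.single_le_sum (f := fun b : (Σ _ : ZMod f, ℕ) => p ^ P b.1 b.2) (fun _ _ => Nat.zero_le _) ha
  omega

theorem cost_inj (p : ℕ) (l : ZMod f → ℤ) (P : ZMod f → ℕ → ℕ) (hG : Good p P) (x y : ZMod f → ℤ)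
    (hx : Feas p l x) (hy : Feas p l y) (h : cost p l P x = cost p l P y) : x = y := by
  rcases (Uu p l x y ∪ Uu p l y x).eq_empty_or_nonempty with h0 | h0
  · apply nn_inj p hG.two l
    intro m
    rw [Finset.union_eq_empty] at h0
    have h1 : ∀ x y : ZMod f → ℤ, Uu p l x y = ∅ → (nn p l y m).toNat ≤ (nn p l x m).toNat := by
      intro x y hxy
      by_contra hc
      have : (⟨m, (nn p l x m).toNat⟩ : Σ _ : ZMod f, ℕ) ∈ Uu p l x y := by
        simp only [Uu, Finset.mem_sigma, Finset.mem_univ, true_and, Finset.mem_Ico]; omega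
      rw [hxy] at this; simp at this
    have := h1 x y h0.1
    have := h1 y x h0.2
    have := (hx m).1; have := (hy m).1
    omega
  · exfalso
    obtain ⟨a, ha, hmax⟩ := Finset.exists_max_image _ (fun a => P a.1 a.2) h0
    rcases Finset.mem_union.mp ha with ha | ha
    · have := cost_dom p l P hG x y a ha fun b hb => hmax b (Finset.mem_union_right _ hb)
      omega
    · have := cost_dom p l P hG y x a ha fun b hb => hmax b (Finset.mem_union_left _ hb)
      omega

/-- closure lemma -/
theorem closure_ex (p : ℕ) (h w ν : ZMod f → ℤ) (hw : ∀ m, h m ≤ w m)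
    (hc : ∀ m, p * w (m + 1) - ν m ≤ w m) :
    ∃ v : ZMod f → ℤ, (∀ m, h m ≤ v m) ∧ (∀ m, v m ≤ w m) ∧
      ∀ m, v m = max (h m) (p * v (m + 1) - ν m) := by
  let S : Set (ZMod f → ℤ) := {v | (∀ m, h m ≤ v m) ∧ (∀ m, v m ≤ w m) ∧
    ∀ m, p * v (m + 1) - ν m ≤ v m}
  have hS : S.Nonempty := ⟨w, hw, fun _ => le_rfl, hc⟩
  let μ : (ZMod f → ℤ) → ℕ := fun v => ∑ m, (v m - h m).toNat
  obtain ⟨v, hv, hmin⟩ := WellFounded.has_min (InvImage.wf μ Nat.lt_wfRel.wf) S hS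
  refine ⟨v, hv.1, hv.2.1, ?_⟩
  have hle : ∀ m, max (h m) (p * v (m + 1) - ν m) ≤ v m := fun m => max_le (hv.1 m) (hv.2.2 m)
  have hΦ : (fun m => max (h m) (p * v (m + 1) - ν m)) ∈ S := by
    refine ⟨fun m => le_max_left _ _, fun m => (hle m).trans (hv.2.1 m), fun m => ?_⟩
    refine le_trans ?_ (le_max_right _ _)
    have := hle (m + 1)
    have hp : (0 : ℤ) ≤ p := by positivity
    have := mul_le_mul_of_nonneg_left this hp
    simp only at *
    linarith
  by_contra hne
  push Not at hne
  obtain ⟨m0, hm0⟩ := hne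
  refine hmin _ hΦ ?_
  show μ _ < μ v
  refine Finset.sum_lt_sum (fun m _ => Int.toNat_le_toNat (by have := hle m; simp only; omega))
    ⟨m0, Finset.mem_univ _, ?_⟩
  have h1 := hle m0
  have h2 : h m0 ≤ max (h m0) (p * v (m0 + 1) - ν m0) := le_max_left _ _
  simp only
  omega

end PS

set_option linter.unusedSectionVars false
namespace PS
variable {f : ℕ} [NeZero f]

theorem submod (p : ℕ) (l : ZMod f → ℤ) (P : ZMod f → ℕ → ℕ) (hG : Good p P) (x y : ZMod f → ℤ)
    (hx : Feas p l x) (hy : Feas p l y) :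
    Feas p l (fun m => min (x m) (y m)) ∧ Feas p l (fun m => max (x m) (y m)) ∧
    cost p l P (fun m => min (x m) (y m)) + cost p l P (fun m => max (x m) (y m))
      ≤ cost p l P x + cost p l P y := by
  have key : ∀ m, nn p l (fun m => min (x m) (y m)) m + nn p l (fun m => max (x m) (y m)) m
        = nn p l x m + nn p l y m ∧
      min (nn p l x m) (nn p l y m) ≤ nn p l (fun m => min (x m) (y m)) m ∧
      nn p l (fun m => min (x m) (y m)) m ≤ max (nn p l x m) (nn p l y m) := by
    intro m
    have hp : (0 : ℤ) ≤ p := by positivity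
    simp only [nn, mul_min_of_nonneg _ _ hp, mul_max_of_nonneg _ _ hp]
    rcases le_total (x m) (y m) with h1 | h1 <;>
      rcases le_total (x (m + 1)) (y (m + 1)) with h2 | h2 <;>
      have h3 := mul_le_mul_of_nonneg_left h2 hp <;>
      refine ⟨?_, ?_, ?_⟩ <;> omega
  refine ⟨fun m => ?_, fun m => ?_, ?_⟩
  · have := key m; have := hx m; have := hy m; omega
  · have := key m; have := hx m; have := hy m; omega
  · simp only [cost, ← Finset.sum_add_distrib]
    refine Finset.sum_le_sum fun m _ => ?_
    have h1 := key m
    have h2 := (hx m).1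
    have h3 := (hy m).1
    rcases le_total (nn p l x m) (nn p l y m) with h | h
    · exact Vv_conv p P hG m _ _ _ _ h2 (by omega) (by omega) (by omega)
    · rw [add_comm (Vv p P m (nn p l x m))]
      exact Vv_conv p P hG m _ _ _ _ h3 (by omega) (by omega) (by omega)

theorem ch_le (p : ℕ) (l T : ZMod f → ℤ)
    (hT : ∀ x : ZMod f → ℤ, (∀ m, 0 ≤ nn p l x m) → ∀ m, x m ≤ T m) :
    ∀ (zs : List (ZMod f → ℤ)) (b z : ZMod f → ℤ), IsCh p l b (z :: zs) →
      ∀ m, z m + zs.length ≤ T m := by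
  intro zs
  induction zs with
  | nil =>
    intro b z h m
    simpa using hT z (fun m => (h.1 m).1) m
  | cons y zs ih =>
    intro b z h m
    have h1 := ih _ y h.2.2 m
    have h2 := h.2.2.2.1 m
    simp only [List.length_cons] at *
    push_cast
    omega

theorem isCh_weaken (p : ℕ) (l : ZMod f → ℤ) (b b' : ZMod f → ℤ) (h : ∀ m, b m ≤ b' m) :
    ∀ zs, IsCh p l b' zs → IsCh p l b zs
  | [], _ => trivial
  | _ :: _, hz => ⟨hz.1, fun m => (h m).trans (hz.2.1 m), hz.2.2⟩

/-- minimal chains -/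
def MinCh (p : ℕ) (l : ZMod f → ℤ) (P : ZMod f → ℕ → ℕ) (b : ZMod f → ℤ)
    (zs : List (ZMod f → ℤ)) : Prop :=
  IsCh p l b zs ∧ ∀ zs', IsCh p l b zs' → zs'.length = zs.length → ccost p l P zs ≤ ccost p l P zs'

theorem MinCh.tail {p : ℕ} {l : ZMod f → ℤ} {P : ZMod f → ℕ → ℕ} {b x : ZMod f → ℤ}
    {zs : List (ZMod f → ℤ)} (h : MinCh p l P b (x :: zs)) :
    MinCh p l P (fun m => x m + 1) zs := by
  refine ⟨h.1.2.2, fun zs' h1 h2 => ?_⟩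
  have := h.2 (x :: zs') ⟨h.1.1, h.1.2.1, h1⟩ (by simp [h2])
  simp only [ccost, List.map_cons, List.sum_cons] at *
  omega

theorem min_mono (p : ℕ) (l : ZMod f → ℤ) (P : ZMod f → ℕ → ℕ) (hG : Good p P)
    (b x z : ZMod f → ℤ) (zs : List (ZMod f → ℤ)) (h : MinCh p l P b (x :: z :: zs)) :
    ∀ m, nn p l z m ≤ nn p l x m := by
  have hp := hG.two
  have hp' : (2 : ℤ) ≤ p := by exact_mod_cast hp
  obtain ⟨⟨hx, hb, hz, hxz, hzs⟩, hmin⟩ := h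
  obtain ⟨v, hv1, hv2, hv3⟩ := closure_ex p (fun m => -(z m - x m)) (fun _ => -1) (fun _ => 0)
    (fun m => by have : x m + 1 ≤ z m := hxz m; omega) (fun m => by omega)
  -- u' = -v, δ = z - x + v
  have hδ0 : ∀ m, 0 ≤ z m - x m + v m := fun m => by have := hv1 m; omega
  have key : ∀ m, nn p l (fun m => x m + (z m - x m + v m)) m + nn p l (fun m => x m - v m) m
      = nn p l x m + nn p l z m ∧
      min (nn p l x m) (nn p l z m) ≤ nn p l (fun m => x m - v m) m ∧
      nn p l (fun m => x m - v m) m ≤ max (nn p l x m) (nn p l z m) := by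
    intro m
    have h1 := hv3 m
    have h2 := mul_nonneg (by positivity : (0 : ℤ) ≤ p) (hδ0 (m + 1))
    have h3 := hδ0 m
    have h4 : (p : ℤ) * (z (m + 1) - x (m + 1) + v (m + 1)) = p * z (m + 1) - p * x (m + 1) + p * v (m + 1) := by ring
    have h5 : (p : ℤ) * (x (m + 1) - v (m + 1)) = p * x (m + 1) - p * v (m + 1) := by ring
    have h6 : (p : ℤ) * (x (m + 1) + (z (m + 1) - x (m + 1) + v (m + 1))) = p * z (m + 1)  + p * v (m + 1) := by ring
    simp only [nn, h5, h6]
    rw [h4] at h2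
    omega
  have f1 : Feas p l (fun m => x m + (z m - x m + v m)) := fun m => by
    have := key m; have := hx m; have := hz m; omega
  have f2 : Feas p l (fun m => x m - v m) := fun m => by
    have := key m; have := hx m; have := hz m; omega
  have hcost : cost p l P (fun m => x m + (z m - x m + v m)) + cost p l P (fun m => x m - v m)
      ≤ cost p l P x + cost p l P z := by
    simp only [cost, ← Finset.sum_add_distrib]
    refine Finset.sum_le_sum fun m _ => ?_
    have h1 := key m
    have h2 := (hx m).1
    have h3 := (hz m).1
    rw [add_comm]
    rcases le_total (nn p l x m) (nn p l z m) with h | h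
    · exact Vv_conv p P hG m _ _ _ _ h2 (by omega) (by omega) (by omega)
    · rw [add_comm (Vv p P m (nn p l x m))]
      exact Vv_conv p P hG m _ _ _ _ h3 (by omega) (by omega) (by omega)
  have m1 := hmin ((fun m => x m + (z m - x m + v m)) :: z :: zs)
    ⟨f1, fun m => by have := hb m; have := hδ0 m; simp only; omega, hz,
      fun m => by have : v m ≤ -1 := hv2 m
                  simp only; omega, hzs⟩ rfl
  have m2 := hmin (x :: (fun m => x m - v m) :: zs)
    ⟨hx, hb, f2, fun m => by have : v m ≤ -1 := hv2 m
                             simp only; omega,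
      isCh_weaken p l _ _ (fun m => by have := hδ0 m; simp only; omega) _ hzs⟩ rfl
  simp only [ccost, List.map_cons, List.sum_cons] at m1 m2
  have h7 := cost_inj p l P hG z _ hz f2 (by omega)
  intro m
  have h8 := hv3 m
  have h9 : z m = x m - v m := congrFun h7 m
  have h10 : z (m + 1) = x (m + 1) - v (m + 1) := congrFun h7 (m + 1)
  have h5 : (p : ℤ) * (x (m + 1) - v (m + 1)) = p * x (m + 1) - p * v (m + 1) := by ring
  simp only [nn, h9, h10, h5]
  omega

theorem min_monoN (p : ℕ) (l : ZMod f → ℤ) (P : ZMod f → ℕ → ℕ) (hG : Good p P) :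
    ∀ (zs : List (ZMod f → ℤ)) (b x : ZMod f → ℤ), MinCh p l P b (x :: zs) → MonoN p l x zs := by
  intro zs
  induction zs with
  | nil => intros; trivial
  | cons z zs ih => exact fun b x h => ⟨min_mono p l P hG b x z zs h, ih _ z h.tail⟩

theorem exists_min (p : ℕ) (l : ZMod f → ℤ) (P : ZMod f → ℕ → ℕ) (b : ZMod f → ℤ) (d : ℕ)
    (h : ∃ zs, IsCh p l b zs ∧ zs.length = d) : ∃ zs, MinCh p l P b zs ∧ zs.length = d := by
  let S : Set (List (ZMod f → ℤ)) := {zs | IsCh p l b zs ∧ zs.length = d}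
  obtain ⟨v, hv, hmin⟩ := WellFounded.has_min (InvImage.wf (ccost p l P) Nat.lt_wfRel.wf) S h
  exact ⟨v, ⟨hv.1, fun zs' h1 h2 => not_lt.mp (hmin zs' ⟨h1, h2.trans hv.2⟩)⟩, hv.2⟩

/-- existence of chains -/
theorem ch_exists (p : ℕ) (hp : 2 ≤ p) (l T : ZMod f → ℤ) (hT : ∀ m, 0 ≤ nn p l T m)
    (hl : ∀ m, 0 ≤ l m) :
    ∀ (d : ℕ) (b : ZMod f → ℤ), (∀ m, 0 ≤ b m) → (∀ m, b m ≤ p * b (m + 1)) →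
      (∀ m, b m + d ≤ T m + 1) →
      ∃ zs, IsCh p l b zs ∧ zs.length = d := by
  have hp' : (2 : ℤ) ≤ p := by exact_mod_cast hp
  intro d
  induction d with
  | zero => exact fun b _ _ _ => ⟨[], trivial, rfl⟩
  | succ d ih =>
    intro b hb hbp hbT
    -- head: greatest u ≤ T - d with u m ≤ p u(m+1)
    obtain ⟨v, hv1, hv2, hv3⟩ := closure_ex p (fun m => -(T m - d)) (fun m => - b m) (fun _ => 0)
      (fun m => by have := hbT m; push_cast at this; omega)
      (fun m => by have := hbp m; linarith)
    have e1 : ∀ m, v m ≤ - b m := hv2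
    have e2 : ∀ m, -(T m - d) ≤ v m := hv1
    obtain ⟨zs, h1, h2⟩ := ih (fun m => - v m + 1) (fun m => by have := hb m; have := e1 m; omega)
      (fun m => by have := hv3 m; have := le_max_right (-(T m - d)) (p * v (m + 1) - 0); nlinarith)
      (fun m => by have := e2 m; omega)
    refine ⟨(fun m => - v m) :: zs, ⟨fun m => ?_, fun m => by have := e1 m; show b m ≤ - v m; omega, h1⟩, by simp [h2]⟩
    have h3 := hv3 m
    have h4 := hT m
    have h5 := mul_le_mul_of_nonneg_left (e2 (m + 1)) (by positivity : (0 : ℤ) ≤ p)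
    have h6 := hl m
    have h7 : 2 * (d : ℤ) ≤ p * d := mul_le_mul_of_nonneg_right hp' (by positivity)
    have h8 : (p : ℤ) * -(T (m + 1) - d) = p * d - p * T (m + 1) := by ring
    have h9 : (p : ℤ) * -(v (m + 1)) = - (p * v (m + 1)) := by ring
    rw [h8] at h5
    simp only [nn, h9] at h4 ⊢
    omega
end PS

set_option linter.unusedSectionVars false
namespace PS
variable {f : ℕ} [NeZero f]

theorem up (p : ℕ) (l : ZMod f → ℤ) (P : ZMod f → ℕ → ℕ) (hG : Good p P) (T : ZMod f → ℤ)
    (hTn : ∀ m, 0 ≤ nn p l T m)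
    (hT : ∀ x : ZMod f → ℤ, (∀ m, 0 ≤ nn p l x m) → ∀ m, x m ≤ T m) :
    ∀ (zs : List (ZMod f → ℤ)) (x V : ZMod f → ℤ), IsCh p l (fun m => x m + 1) zs →
      MonoN p l x zs → (∀ m, nn p l x m ≤ l m) → (∀ m, 0 ≤ V m) →
      (∀ m, V m ≤ 1 ∨ V m = p * V (m + 1) - nn p l x m) →
      (∀ m, x m + V m + zs.length ≤ T m) →
      ∃ (zs' : List (ZMod f → ℤ)) (S : Finset ℕ), IsCh p l (fun m => x m + V m + 1) zs' ∧
        zs'.length = zs.length ∧ ccost p l P zs' ≤ ccost p l P zs + ∑ j ∈ S, p ^ j ∧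
        ∀ j ∈ S, ∃ (m : ZMod f) (t : ℕ), j = P m t ∧ 1 ≤ V m ∧ V m ≠ p * V (m + 1) - nn p l x m ∧
          (t : ℤ) + (p - 1) ≤ nn p l x m ∧ (1 ≤ V (m + 1) → (t : ℤ) + (p - 1) + p ≤ nn p l x m) := by
  have hp := hG.two
  have hp' : (2 : ℤ) ≤ p := by exact_mod_cast hp
  have hp0 : (0 : ℤ) ≤ p := by positivity
  intro zs
  induction zs with
  | nil =>
    intro x V _ _ _ _ _ _
    exact ⟨[], ∅, trivial, rfl, by simp, by simp⟩
  | cons z zs ih =>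
    intro x V hch hmono hxl hV hinv hb
    have hzT := ch_le p l T hT zs _ z hch
    obtain ⟨hz, hxz, hzs⟩ := hch
    obtain ⟨hzx, hmono'⟩ := hmono
    have hxz' : ∀ m, x m + 1 ≤ z m := hxz
    have hb' : ∀ m, x m + V m + zs.length + 1 ≤ T m := fun m => by
      have := hb m; simp only [List.length_cons] at this; push_cast at this; omega
    have hnz : ∀ m, nn p l z m = nn p l x m + (z m - x m - 1) + 1
        - p * (z (m + 1) - x (m + 1) - 1) - p := fun m => by simp only [nn]; ring
    obtain ⟨v, hv1, hv2, hv3⟩ := closure_ex p (fun m => max 0 (V m - (z m - x m - 1)))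
      (fun m => T m - zs.length - z m) (nn p l z)
      (fun m => by have := hzT m; have := hb' m; omega)
      (fun m => by
        have h1 := hTn m
        have h2 : (0 : ℤ) ≤ (p - 1) * zs.length := mul_nonneg (by omega) (by positivity)
        simp only [nn] at h1 ⊢
        linarith)
    have hv0 : ∀ m, 0 ≤ v m := fun m => (le_max_left _ _).trans (hv1 m)
    have hvV : ∀ m, V m - (z m - x m - 1) ≤ v m := fun m => (le_max_right _ _).trans (hv1 m)
    have hvb : ∀ m, p * v (m + 1) - nn p l z m ≤ v m := fun m => by
      rw [hv3 m]; exact le_max_right _ _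
    have hvT : ∀ m, z m + v m + zs.length ≤ T m := fun m => by
      have : v m ≤ T m - zs.length - z m := hv2 m
      omega
    have hact : ∀ m, v m ≠ p * v (m + 1) - nn p l z m → 1 ≤ v m →
        v m = 1 ∧ z m - x m - 1 = 0 ∧ V m = 1 ∧ V m ≠ p * V (m + 1) - nn p l x m := by
      intro m h1 h2
      have h3 := hv3 m
      have h4 : v m = V m - (z m - x m - 1) := by omega
      have h5 := mul_le_mul_of_nonneg_left (hvV (m + 1)) hp0
      have h6 := hnz m
      have h7 := hvb m
      have h8 : V m ≠ p * V (m + 1) - nn p l x m := by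
        intro h
        nlinarith
      have h9 := hinv m
      have h10 := hxz' m
      omega
    obtain ⟨zs', S', c1, c2, c3, c4⟩ := ih z v hzs hmono' (fun m => (hz m).2) hv0
      (fun m => by
        by_cases h : v m = p * v (m + 1) - nn p l z m
        · exact Or.inr h
        · left
          by_contra hc
          have := hact m h (by omega)
          omega) hvT
    have hloss : ∀ m, v m ≠ p * v (m + 1) - nn p l z m → 1 ≤ v m → v (m + 1) = 0 →
        nn p l z m + (p - 1) + p * V (m + 1) ≤ nn p l x m := by
      intro m h1 h2 h3
      have h4 := hact m h1 h2
      have h5 := mul_le_mul_of_nonneg_left (hvV (m + 1)) hp0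
      have h6 := hnz m
      rw [h3] at h5
      rw [h4.2.1] at h6
      nlinarith
    let Loss : Finset (ZMod f) := Finset.univ.filter fun m =>
      v m ≠ p * v (m + 1) - nn p l z m ∧ 1 ≤ v m ∧ v (m + 1) = 0
    have hL : ∀ m, m ∈ Loss ↔ (v m ≠ p * v (m + 1) - nn p l z m ∧ 1 ≤ v m ∧ v (m + 1) = 0) :=
      fun m => by simp [Loss]
    have hnv : ∀ m, nn p l (fun m => z m + v m) m = nn p l z m + v m - p * v (m + 1) :=
      fun m => by simp only [nn]; ring
    have hcase : ∀ m, (m ∈ Loss ∧ nn p l (fun m => z m + v m) m = nn p l z m + 1) ∨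
        (m ∉ Loss ∧ nn p l (fun m => z m + v m) m ≤ nn p l z m) := by
      intro m
      rw [hnv m, hL m]
      by_cases h1 : v m = p * v (m + 1) - nn p l z m
      · have := (hz m).1
        exact Or.inr ⟨fun h => h.1 h1, by omega⟩
      have h5 := mul_nonneg hp0 (hv0 (m + 1))
      by_cases h2 : 1 ≤ v m
      · have h4 := hact m h1 h2
        by_cases h3 : v (m + 1) = 0
        · left
          refine ⟨⟨h1, h2, h3⟩, ?_⟩
          rw [h3, h4.1]; ring
        · right
          refine ⟨fun h => h3 h.2.2, ?_⟩
          have := hv0 (m + 1)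
          have h6 : 1 ≤ v (m + 1) := by omega
          have := mul_le_mul_of_nonneg_left h6 hp0
          omega
      · right
        refine ⟨fun h => h2 h.2.1, ?_⟩
        omega
    have hfeas : Feas p l (fun m => z m + v m) := by
      intro m
      refine ⟨by rw [hnv]; have := hvb m; omega, ?_⟩
      rcases hcase m with ⟨h1, h2⟩ | ⟨h1, h2⟩
      · have h3 := (hL m).1 h1
        have h4 := hloss m h3.1 h3.2.1 h3.2.2
        have h5 := mul_nonneg hp0 (hV (m + 1))
        have := hxl m
        omega
      · have := (hz m).2; omega
    have hcost : cost p l P (fun m => z m + v m)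
        ≤ cost p l P z + ∑ m ∈ Loss, p ^ P m (nn p l z m).toNat := by
      have : ∑ m ∈ Loss, p ^ P m (nn p l z m).toNat
          = ∑ m, if m ∈ Loss then p ^ P m (nn p l z m).toNat else 0 := by
        rw [Finset.sum_ite_mem]; simp
      rw [this]
      simp only [cost, ← Finset.sum_add_distrib]
      refine Finset.sum_le_sum fun m _ => ?_
      rcases hcase m with ⟨h1, h2⟩ | ⟨h1, h2⟩
      · rw [h2, if_pos h1, Vv_succ _ _ _ (hz m).1]
      · rw [if_neg h1]; exact Vv_mono p P m h2
    refine ⟨(fun m => z m + v m) :: zs', Loss.image (fun m => P m (nn p l z m).toNat) ∪ S',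
      ⟨hfeas, fun m => ?_, c1⟩, by simp [c2], ?_, ?_⟩
    · have := hvV m
      show x m + V m + 1 ≤ z m + v m
      omega
    · have hdis : Disjoint (Loss.image (fun m => P m (nn p l z m).toNat)) S' := by
        rw [Finset.disjoint_left]
        intro j hj hj'
        obtain ⟨m, hm, rfl⟩ := Finset.mem_image.mp hj
        obtain ⟨m', t, e1, -, -, e2, -⟩ := c4 _ hj'
        have := hG.cls _ _ _ _ e1
        subst this
        have h1 := hG.mult m t
        have h2 := hG.mono m (show t + (p - 1) ≤ (nn p l z m).toNat by omega)
        omega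
      rw [Finset.sum_union hdis, Finset.sum_image (fun a _ b _ h => hG.cls _ _ _ _ h)]
      simp only [ccost, List.map_cons, List.sum_cons] at c3 ⊢
      omega
    · intro j hj
      rcases Finset.mem_union.mp hj with hj | hj
      · obtain ⟨m, hm, rfl⟩ := Finset.mem_image.mp hj
        have h3 := (hL m).1 hm
        have h4 := hloss m h3.1 h3.2.1 h3.2.2
        have h6 := hact m h3.1 h3.2.1
        have h5 := mul_nonneg hp0 (hV (m + 1))
        have h7 := (hz m).1
        refine ⟨m, _, rfl, by omega, h6.2.2.2, by omega, fun h => ?_⟩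
        have := mul_le_mul_of_nonneg_left h hp0
        omega
      · obtain ⟨m, t, e1, e2, e3, e4, e5⟩ := c4 _ hj
        have h6 := hact m e3 e2
        have h7 := hzx m
        refine ⟨m, t, e1, by omega, h6.2.2.2, by omega, fun h => ?_⟩
        by_cases h3 : v (m + 1) = 0
        · have h4 := hloss m e3 e2 h3
          have := mul_le_mul_of_nonneg_left h hp0
          omega
        · have := e5 (by have := hv0 (m + 1); omega)
          omega
end PS

set_option linter.unusedSectionVars false
namespace PS
variable {f : ℕ} [NeZero f]

theorem main_aux (p : ℕ) (l : ZMod f → ℤ) (P : ZMod f → ℕ → ℕ) (hG : Good p P) (T : ZMod f → ℤ)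
    (hTn : ∀ m, 0 ≤ nn p l T m)
    (hT : ∀ x : ZMod f → ℤ, (∀ m, 0 ≤ nn p l x m) → ∀ m, x m ≤ T m)
    (zs : List (ZMod f → ℤ)) (b x y : ZMod f → ℤ) (hmin : MinCh p l P b (x :: zs))
    (hy : Feas p l y) (hxy : ∀ m, x m ≤ y m) (hyT : ∀ m, y m + zs.length ≤ T m) :
    cost p l P x ≤ cost p l P y := by
  have hp := hG.two
  have hp' : (2 : ℤ) ≤ p := by exact_mod_cast hp
  have hp0 : (0 : ℤ) ≤ p := by positivity
  by_contra hlt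
  have hmono := min_monoN p l P hG zs b x hmin
  obtain ⟨⟨hx, hb, hzs⟩, hmin⟩ := hmin
  have hny : ∀ m, nn p l y m = nn p l x m + (y m - x m) - p * (y (m + 1) - x (m + 1)) :=
    fun m => by simp only [nn]; ring
  let G : Finset (ZMod f) := Finset.univ.filter fun m => 1 ≤ y (m + 1) - x (m + 1) ∧ 0 < nn p l x m
  have hGm : ∀ m, m ∈ G ↔ (1 ≤ y (m + 1) - x (m + 1) ∧ 0 < nn p l x m) := fun m => by simp [G]
  have hgain : ∀ m, nn p l y m < nn p l x m → m ∈ G := by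
    intro m hm
    rw [hGm]
    have h1 := (hy m).1
    refine ⟨?_, by omega⟩
    by_contra hc
    have h2 := hxy (m + 1)
    have h3 : y (m + 1) - x (m + 1) = 0 := by omega
    have h4 := hny m
    rw [h3] at h4
    have := hxy m
    omega
  have hGne : G.Nonempty := by
    rw [Finset.nonempty_iff_ne_empty]
    intro hE
    apply hlt
    refine Finset.sum_le_sum fun m _ => Vv_mono p P m ?_
    by_contra hc
    have := hgain m (by omega)
    rw [hE] at this
    simp at this
  obtain ⟨i, hi, hmax⟩ := Finset.exists_max_image G (fun m => P m (nn p l x m - 1).toNat) hGne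
  obtain ⟨e, he⟩ : ∃ e, e = P i (nn p l x i - 1).toNat := ⟨_, rfl⟩
  have hmax' : ∀ m ∈ G, P m (nn p l x m - 1).toNat ≤ e := fun m hm => he ▸ hmax m hm
  have hlost : ∀ a ∈ Uu p l x y, P a.1 a.2 < e := by
    intro a ha
    by_contra hc
    apply hlt
    refine (cost_dom p l P hG x y a ha fun c hc' => ?_).le
    simp only [Uu, Finset.mem_sigma, Finset.mem_univ, true_and, Finset.mem_Ico] at hc'
    have h1 := hmax' c.1 (hgain c.1 (by omega))
    have h2 := hG.mono c.1 (show c.2 ≤ (nn p l x c.1 - 1).toNat by omega)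
    omega
  obtain ⟨v, hv1, hv2, hv3⟩ := closure_ex p (fun m => min 1 (y m - x m)) (fun m => y m - x m)
    (nn p l x) (fun m => by omega) (fun m => by have := hny m; have := (hy m).1; omega)
  have hv1' : ∀ m, min 1 (y m - x m) ≤ v m := hv1
  have hv2' : ∀ m, v m ≤ y m - x m := hv2
  have hv0 : ∀ m, 0 ≤ v m := fun m => by have := hv1' m; have := hxy m; omega
  have hvb : ∀ m, p * v (m + 1) - nn p l x m ≤ v m := fun m => by
    rw [hv3 m]; exact le_max_right _ _
  have hact : ∀ m, v m ≠ p * v (m + 1) - nn p l x m → v m ≤ 1 := by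
    intro m h1
    have h3 := hv3 m
    omega
  let Loss : Finset (ZMod f) := Finset.univ.filter fun m =>
    v m ≠ p * v (m + 1) - nn p l x m ∧ 1 ≤ v m ∧ v (m + 1) = 0
  have hL : ∀ m, m ∈ Loss ↔ (v m ≠ p * v (m + 1) - nn p l x m ∧ 1 ≤ v m ∧ v (m + 1) = 0) :=
    fun m => by simp [Loss]
  have hnv : ∀ m, nn p l (fun m => x m + v m) m = nn p l x m + v m - p * v (m + 1) :=
    fun m => by simp only [nn]; ring
  have hcase : ∀ m, (m ∈ Loss ∧ nn p l (fun m => x m + v m) m = nn p l x m + 1) ∨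
      (m ∉ Loss ∧ nn p l (fun m => x m + v m) m ≤ nn p l x m) := by
    intro m
    rw [hnv m, hL m]
    by_cases h1 : v m = p * v (m + 1) - nn p l x m
    · have := (hx m).1
      exact Or.inr ⟨fun h => h.1 h1, by omega⟩
    have h5 := mul_nonneg hp0 (hv0 (m + 1))
    have h4 := hact m h1
    by_cases h2 : 1 ≤ v m
    · by_cases h3 : v (m + 1) = 0
      · left
        refine ⟨⟨h1, h2, h3⟩, ?_⟩
        rw [h3]; omega
      · right
        refine ⟨fun h => h3 h.2.2, ?_⟩
        have := hv0 (m + 1)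
        have h6 : 1 ≤ v (m + 1) := by omega
        have := mul_le_mul_of_nonneg_left h6 hp0
        omega
    · right
      refine ⟨fun h => h2 h.2.1, ?_⟩
      omega
  have hlossy : ∀ m ∈ Loss, nn p l x m + 1 ≤ nn p l y m := by
    intro m hm
    have h1 := (hL m).1 hm
    have h2 := hny m
    have h3 := hv1' (m + 1)
    have h4 := hv2' m
    have h5 := hxy (m + 1)
    have h6 : y (m + 1) - x (m + 1) = 0 := by omega
    rw [h6] at h2
    omega
  have hlosse : ∀ m ∈ Loss, P m (nn p l x m).toNat < e := by
    intro m hm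
    refine hlost ⟨m, (nn p l x m).toNat⟩ ?_
    have := hlossy m hm
    have := (hx m).1
    simp only [Uu, Finset.mem_sigma, Finset.mem_univ, true_and, Finset.mem_Ico]
    omega
  have hfeas : Feas p l (fun m => x m + v m) := by
    intro m
    refine ⟨by rw [hnv]; have := hvb m; omega, ?_⟩
    rcases hcase m with ⟨h1, h2⟩ | ⟨h1, h2⟩
    · have := hlossy m h1
      have := (hy m).2
      omega
    · have := (hx m).2; omega
  have hiG := (hGm i).1 hi
  have hvi : 1 ≤ v (i + 1) := by have := hv1' (i + 1); omega
  have hiL : i ∉ Loss := fun h => by have := (hL i).1 h; omega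
  have hni : nn p l (fun m => x m + v m) i ≤ nn p l x i - 1 := by
    rw [hnv]
    by_cases h1 : v i = p * v (i + 1) - nn p l x i
    · omega
    · have := hact i h1
      have := mul_le_mul_of_nonneg_left hvi hp0
      omega
  have hcost : cost p l P (fun m => x m + v m) + p ^ e
      ≤ cost p l P x + ∑ m ∈ Loss, p ^ P m (nn p l x m).toNat := by
    have e1 : ∑ m ∈ Loss, p ^ P m (nn p l x m).toNat
        = ∑ m, if m ∈ Loss then p ^ P m (nn p l x m).toNat else 0 := by
      rw [Finset.sum_ite_mem]; simp
    have e2 : p ^ e = ∑ m : ZMod f, if m = i then p ^ e else 0 := by simp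
    rw [e1, e2]
    simp only [cost, ← Finset.sum_add_distrib]
    refine Finset.sum_le_sum fun m _ => ?_
    by_cases hmi : m = i
    · subst hmi
      rw [if_pos rfl, if_neg hiL, he]
      have h1 := Vv_succ p P m (show 0 ≤ nn p l x m - 1 by omega)
      rw [sub_add_cancel] at h1
      have := Vv_mono p P m hni
      omega
    rw [if_neg hmi]
    rcases hcase m with ⟨h1, h2⟩ | ⟨h1, h2⟩
    · rw [h2, if_pos h1, Vv_succ _ _ _ (hx m).1, add_zero]
    · rw [if_neg h1]; exact Vv_mono p P m h2
  obtain ⟨zs', S, c1, c2, c3, c4⟩ := up p l P hG T hTn hT zs x v hzs hmono (fun m => (hx m).2) hv0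
    (fun m => by
      by_cases h : v m = p * v (m + 1) - nn p l x m
      · exact Or.inr h
      · exact Or.inl (hact m h))
    (fun m => by have := hv2' m; have := hyT m; omega)
  have hM := hmin ((fun m => x m + v m) :: zs')
    ⟨hfeas, fun m => by have := hv0 m; have := hb m; show b m ≤ x m + v m; omega, c1⟩ (by simp [c2])
  have hdis : Disjoint (Loss.image (fun m => P m (nn p l x m).toNat)) S := by
    rw [Finset.disjoint_left]
    intro j hj hj'
    obtain ⟨m, hm, rfl⟩ := Finset.mem_image.mp hj
    obtain ⟨m', t, e1, -, -, e2, -⟩ := c4 _ hj'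
    have := hG.cls _ _ _ _ e1
    subst this
    have h1 := hG.mult m t
    have h2 := hG.mono m (show t + (p - 1) ≤ (nn p l x m).toNat by omega)
    omega
  have hlt2 : ∑ j ∈ Loss.image (fun m => P m (nn p l x m).toNat) ∪ S, p ^ j < p ^ e := by
    refine Nat.geomSum_lt hp fun j hj => ?_
    rcases Finset.mem_union.mp hj with hj | hj
    · obtain ⟨m, hm, rfl⟩ := Finset.mem_image.mp hj
      exact hlosse m hm
    · obtain ⟨m, t, e1, e2, e3, e4, e5⟩ := c4 _ hj
      rw [e1]
      by_cases h3 : v (m + 1) = 0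
      · have h4 := hlosse m ((hL m).2 ⟨e3, e2, h3⟩)
        have h5 := hG.mono m (show t ≤ (nn p l x m).toNat by omega)
        omega
      · have h6 : 1 ≤ v (m + 1) := by have := hv0 (m + 1); omega
        have h7 := e5 h6
        have h8 := hmax' m ((hGm m).2 ⟨by have := hv2' (m + 1); omega, by omega⟩)
        have h9 := hG.mult m t
        have h10 := hG.mono m (show t + (p - 1) ≤ (nn p l x m - 1).toNat by omega)
        omega
  rw [Finset.sum_union hdis, Finset.sum_image (fun a _ b _ h => hG.cls _ _ _ _ h)] at hlt2
  simp only [ccost, List.map_cons, List.sum_cons] at c3 hM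
  omega

theorem main_claim (p : ℕ) (l : ZMod f → ℤ) (P : ZMod f → ℕ → ℕ) (hG : Good p P) (T : ZMod f → ℤ)
    (hTn : ∀ m, 0 ≤ nn p l T m)
    (hT : ∀ x : ZMod f → ℤ, (∀ m, 0 ≤ nn p l x m) → ∀ m, x m ≤ T m)
    (zs : List (ZMod f → ℤ)) (b x y : ZMod f → ℤ) (hmin : MinCh p l P b (x :: zs))
    (hy : Feas p l y) (hby : ∀ m, b m ≤ y m) (hyT : ∀ m, y m + zs.length ≤ T m) :
    cost p l P x ≤ cost p l P y := by
  obtain ⟨s1, s2, s3⟩ := submod p l P hG x y hmin.1.1 hy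
  have hxT := ch_le p l T hT zs _ x hmin.1
  have h1 := main_aux p l P hG T hTn hT zs b x _ hmin s2 (fun m => le_max_left _ _)
    (fun m => by have := hxT m; have := hyT m; omega)
  have h2 := hmin.2 ((fun m => min (x m) (y m)) :: zs)
    ⟨s1, fun m => le_min (hmin.1.2.1 m) (hby m),
      isCh_weaken p l _ _ (fun m => by have := min_le_left (x m) (y m); show min (x m) (y m) + 1 ≤ x m + 1; omega) _ hmin.1.2.2⟩ rfl
  simp only [ccost, List.map_cons, List.sum_cons] at h2
  omega

theorem min_unique (p : ℕ) (l : ZMod f → ℤ) (P : ZMod f → ℕ → ℕ) (hG : Good p P) (T : ZMod f → ℤ)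
    (hTn : ∀ m, 0 ≤ nn p l T m)
    (hT : ∀ x : ZMod f → ℤ, (∀ m, 0 ≤ nn p l x m) → ∀ m, x m ≤ T m) :
    ∀ (zs zs' : List (ZMod f → ℤ)) (b : ZMod f → ℤ), MinCh p l P b zs → MinCh p l P b zs' →
      zs.length = zs'.length → zs = zs' := by
  intro zs
  induction zs with
  | nil => intro zs' b _ _ h; exact (List.length_eq_zero_iff.mp h.symm).symm
  | cons x xs ih =>
    intro zs' b h1 h2 h
    cases zs' with
    | nil => simp at h
    | cons y ys =>
      have hl : xs.length = ys.length := by simpa using h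
      have hx := ch_le p l T hT _ _ _ h1.1
      have hy := ch_le p l T hT _ _ _ h2.1
      have a1 := main_claim p l P hG T hTn hT xs b x y h1 h2.1.1 h2.1.2.1 (by rwa [hl])
      have a2 := main_claim p l P hG T hTn hT ys b y x h2 h1.1.1 h1.1.2.1 (by rwa [← hl])
      have a3 := cost_inj p l P hG x y h1.1.1 h2.1.1 (le_antisymm a1 a2)
      subst a3
      rw [ih ys _ h1.tail h2.tail hl]
end PS

set_option linter.unusedSectionVars false
namespace PS

theorem nth_sum_le (Q : ℕ → Prop) [DecidablePred Q] (g : ℕ → ℕ) (hg : Monotone g) :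
    ∀ A : Finset ℕ, (∀ s ∈ A, Q s) → ∑ t ∈ Finset.range A.card, g (Nat.nth Q t) ≤ ∑ s ∈ A, g s := by
  intro A
  induction A using Finset.induction_on_max with
  | empty => simp
  | insert a A hmax ih =>
    intro h
    have ha : a ∉ A := fun h => lt_irrefl _ (hmax a h)
    rw [Finset.card_insert_of_notMem ha, Finset.sum_range_succ, Finset.sum_insert ha]
    have h1 := ih fun s hs => h s (Finset.mem_insert_of_mem hs)
    have h2 : A.card ≤ Nat.count Q a := by
      rw [Nat.count_eq_card_filter_range]
      refine Finset.card_le_card fun s hs => ?_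
      rw [Finset.mem_filter, Finset.mem_range]
      exact ⟨hmax s hs, h s (Finset.mem_insert_of_mem hs)⟩
    have hQa := h a (Finset.mem_insert_self _ _)
    have h3 : Nat.nth Q A.card ≤ a := by
      have h4 : A.card < Nat.count Q (a + 1) := by
        rw [Nat.count_succ, if_pos hQa]; omega
      have := Nat.nth_lt_of_lt_count h4
      omega
    have := hg h3
    omega

theorem nth_sum_eq (Q : ℕ → Prop) [DecidablePred Q] (g : ℕ → ℕ) (N : ℕ) :
    ∑ t ∈ Finset.range (Nat.count Q N), g (Nat.nth Q t) = ∑ s ∈ Finset.range N with Q s, g s := by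
  induction N with
  | zero => simp
  | succ N ih =>
    rw [Nat.count_succ, Finset.range_add_one, Finset.filter_insert]
    by_cases h : Q N
    · rw [if_pos h, if_pos h, Finset.sum_range_succ, Finset.sum_insert (by simp), ih,
        Nat.nth_count h, add_comm]
    · rw [if_neg h, if_neg h, add_zero, ih]

theorem sum_slots (c M : ℕ) (hc : 0 < c) (F : ℕ → ℕ → ℕ) :
    ∑ s ∈ Finset.range (M * c), F (s / c) (s % c)
      = ∑ i ∈ Finset.range M, ∑ r ∈ Finset.range c, F i r := by
  induction M with
  | zero => simp
  | succ M ih =>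
    rw [add_mul, one_mul, Finset.sum_range_add, ih, Finset.sum_range_succ]
    congr 1
    refine Finset.sum_congr rfl fun r hr => ?_
    have hr' := Finset.mem_range.mp hr
    rw [Nat.add_comm, Nat.add_mul_div_right _ _ hc, Nat.div_eq_of_lt hr', zero_add,
      Nat.add_mul_mod_self_right, Nat.mod_eq_of_lt hr']

/-- base `p` digits -/
def dg (p j i : ℕ) : ℕ := j / p ^ i % p

theorem sum_dg (p : ℕ) : ∀ (M j : ℕ), j < p ^ M → ∑ i ∈ Finset.range M, dg p j i * p ^ i = j := by
  intro M
  induction M with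
  | zero => intro j hj; simp at hj; simp [hj]
  | succ M ih =>
    intro j hj
    rw [Finset.sum_range_succ']
    have h1 : j / p < p ^ M := by
      apply Nat.div_lt_of_lt_mul
      rwa [pow_succ'] at hj
    have h2 := ih _ h1
    have h3 : ∑ i ∈ Finset.range M, dg p j (i + 1) * p ^ (i + 1)
        = p * ∑ i ∈ Finset.range M, dg p (j / p) i * p ^ i := by
      rw [Finset.mul_sum]
      refine Finset.sum_congr rfl fun i _ => ?_
      simp only [dg, Nat.div_div_eq_div_mul, pow_succ']
      ring
    rw [h3, h2]
    simp only [dg, pow_zero, Nat.div_one, mul_one]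
    exact Nat.div_add_mod j p

theorem dg_sum (p : ℕ) (hp : 0 < p) : ∀ (M : ℕ) (c : ℕ → ℕ), (∀ i, c i < p) → ∀ i < M,
    dg p (∑ i ∈ Finset.range M, c i * p ^ i) i = c i := by
  intro M
  induction M with
  | zero => intro c _ i hi; omega
  | succ M ih =>
    intro c hc i hi
    have h3 : ∑ i ∈ Finset.range (M + 1), c i * p ^ i
        = c 0 + p * ∑ i ∈ Finset.range M, c (i + 1) * p ^ i := by
      rw [Finset.sum_range_succ', Finset.mul_sum, add_comm]
      simp only [pow_zero, mul_one]
      congr 1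
      refine Finset.sum_congr rfl fun i _ => ?_
      rw [pow_succ']; ring
    rw [h3]
    cases i with
    | zero => simp [dg, Nat.mod_eq_of_lt (hc 0)]
    | succ i =>
      have := ih (fun i => c (i + 1)) (fun i => hc _) i (by omega)
      rw [← this]
      simp only [dg]
      rw [pow_succ', ← Nat.div_div_eq_div_mul, Nat.add_mul_div_left _ _ hp,
        Nat.div_eq_of_lt (hc 0), zero_add]

theorem sum_dg_lt (p : ℕ) (M : ℕ) (c : ℕ → ℕ) (hc : ∀ i, c i < p) :
    ∑ i ∈ Finset.range M, c i * p ^ i < p ^ M := by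
  induction M with
  | zero => simp
  | succ M ih =>
    rw [Finset.sum_range_succ, pow_succ]
    have := hc M
    have : c M * p ^ M + p ^ M ≤ p ^ M * p := by
      rw [mul_comm (p ^ M), ← Nat.succ_mul]
      exact Nat.mul_le_mul_right _ (by omega)
    omega

theorem lucas_iff (p : ℕ) (hp : p.Prime) (M a b : ℕ) (ha : a < p ^ M) (hb : b < p ^ M) :
    ¬ p ∣ a.choose b ↔ ∀ i < M, dg p b i ≤ dg p a i := by
  have hF : Fact p.Prime := ⟨hp⟩
  have h1 := Choose.choose_modEq_prod_range_choose_nat (p := p) ha hb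
  rw [(Nat.ModEq.dvd_iff h1 dvd_rfl), hp.prime.dvd_finsetProd_iff]
  push Not
  refine ⟨fun h i hi => ?_, fun h i hi => ?_⟩
  · have := h i (Finset.mem_range.mpr hi)
    by_contra hc
    have hc' : a / p ^ i % p < b / p ^ i % p := not_le.mp hc
    exact this (by rw [Nat.choose_eq_zero_of_lt hc']; simp)
  · have h2 := h i (Finset.mem_range.mp hi)
    intro h3
    have h5 : (a / p ^ i % p) < p := Nat.mod_lt _ hp.pos
    have h6 := (h3.mul_right _).mul_right _ |>.trans
      (dvd_of_eq (Nat.choose_mul_factorial_mul_factorial (n := a / p ^ i % p) (k := b / p ^ i % p) h2))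
    exact absurd ((hp.dvd_factorial).1 h6) (by omega)
end PS

set_option linter.unusedSectionVars false
namespace PS
variable {f : ℕ} [NeZero f]

def Sl (p M k : ℕ) (m : ZMod f) (s : ℕ) : Prop :=
  ((s / (p - 1) : ℕ) : ZMod f) = m ∧
    s % (p - 1) < (if s / (p - 1) < M then dg p k (s / (p - 1)) else p - 1)

instance (p M k : ℕ) (m : ZMod f) : DecidablePred (Sl p M k m) :=
  fun _ => inferInstanceAs (Decidable (_ ∧ _))

noncomputable def PP (p M k : ℕ) (m : ZMod f) (t : ℕ) : ℕ := Nat.nth (Sl p M k m) t / (p - 1)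

theorem Sl_inf (p M k : ℕ) (hp : 2 ≤ p) (m : ZMod f) : (Set.ofPred (Sl p M k m)).Infinite := by
  rw [Set.infinite_iff_exists_gt]
  intro a
  have hc : 0 < p - 1 := by omega
  have hf : 0 < f := Nat.pos_of_ne_zero (NeZero.ne f)
  refine ⟨(m.val + f * (M + a + 1)) * (p - 1), ?_, ?_⟩
  · show Sl p M k m _
    unfold Sl
    rw [Nat.mul_div_cancel _ hc, Nat.mul_mod_left, if_neg (by nlinarith)]
    refine ⟨by simp, hc⟩
  · have : a < f * (M + a + 1) := by nlinarith
    nlinarith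

theorem PP_cls (p M k : ℕ) (hp : 2 ≤ p) (m : ZMod f) (t : ℕ) :
    ((PP p M k m t : ℕ) : ZMod f) = m :=
  (Nat.nth_mem_of_infinite (Sl_inf p M k hp m) t).1

theorem good (p M k : ℕ) (hp : 2 ≤ p) : Good p (PP p M k (f := f)) where
  two := hp
  mono m a b h := Nat.div_le_div_right (Nat.nth_monotone (Sl_inf p M k hp m) h)
  mult m t := by
    have hs := Nat.nth_strictMono (Sl_inf p M k hp m)
    have h1 : ∀ c, Nat.nth (Sl p M k m) t + c ≤ Nat.nth (Sl p M k m) (t + c) := by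
      intro c
      induction c with
      | zero => simp
      | succ c ih =>
        have := hs (show t + c < t + (c + 1) by omega)
        omega
    have h2 := h1 (p - 1)
    unfold PP
    refine lt_of_lt_of_le ?_ (Nat.div_le_div_right h2)
    rw [Nat.add_div_right _ (by omega)]
    omega
  cls m m' t t' h := by
    rw [← PP_cls p M k hp m t, h, PP_cls p M k hp m' t']

/-- digit sums by class -/
def Gm (p M j : ℕ) (m : ZMod f) : ℕ := ∑ i ∈ Finset.range M with ((i : ℕ) : ZMod f) = m, dg p j i

theorem slot_sum (p M j : ℕ) (hp : 2 ≤ p) (m : ZMod f) (g : ℕ → ℕ) :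
    ∑ s ∈ Finset.range (M * (p - 1)) with
      (((s / (p - 1) : ℕ) : ZMod f) = m ∧ s % (p - 1) < dg p j (s / (p - 1))), g (s / (p - 1))
      = ∑ i ∈ Finset.range M with ((i : ℕ) : ZMod f) = m, dg p j i * g i := by
  rw [Finset.sum_filter, Finset.sum_filter, sum_slots (p - 1) M (by omega)
    (fun i r => if ((i : ℕ) : ZMod f) = m ∧ r < dg p j i then g i else 0)]
  refine Finset.sum_congr rfl fun i _ => ?_
  by_cases h : ((i : ℕ) : ZMod f) = m
  · simp only [h, true_and, if_true]
    rw [← Finset.sum_filter, Finset.sum_const, smul_eq_mul]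
    congr 1
    have : dg p j i < p := Nat.mod_lt _ (by omega)
    have : (Finset.range (p - 1)).filter (fun r => r < dg p j i) = Finset.range (dg p j i) := by
      ext r; simp only [Finset.mem_filter, Finset.mem_range]; omega
    rw [this, Finset.card_range]
  · simp [h]

theorem sum_cls (p M j : ℕ) (hj : j < p ^ M) :
    ∑ m : ZMod f, ∑ i ∈ Finset.range M with ((i : ℕ) : ZMod f) = m, dg p j i * p ^ i = j := by
  rw [Finset.sum_fiberwise, sum_dg p M j hj]

theorem cost_le (p M k j : ℕ) (hp : 2 ≤ p) (hj : j < p ^ M) (hd : ∀ i < M, dg p j i ≤ dg p k i)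
    (l x : ZMod f → ℤ) (hx : ∀ m, nn p l x m = Gm p M j m) : cost p l (PP p M k) x ≤ j := by
  conv_rhs => rw [← sum_cls (f := f) p M j hj]
  unfold cost
  refine Finset.sum_le_sum fun m _ => ?_
  rw [← slot_sum p M j hp m (fun i => p ^ i), hx, Vv, Int.toNat_natCast]
  have h1 : Gm p M j m = (Finset.filter (fun s => ((s / (p - 1) : ℕ) : ZMod f) = m ∧
      s % (p - 1) < dg p j (s / (p - 1))) (Finset.range (M * (p - 1)))).card := by
    have := slot_sum p M j hp m (fun _ => 1)
    simp only [mul_one] at this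
    rw [Finset.card_eq_sum_ones, this, Gm]
  rw [h1]
  refine nth_sum_le (Sl p M k m) (fun s => p ^ (s / (p - 1))) ?_ _ ?_
  · intro a b h
    exact Nat.pow_le_pow_right (by omega) (Nat.div_le_div_right h)
  · intro s hs
    rw [Finset.mem_filter, Finset.mem_range] at hs
    have : s / (p - 1) < M := Nat.div_lt_of_lt_mul (by rw [mul_comm]; exact hs.1)
    refine ⟨hs.2.1, ?_⟩
    rw [if_pos this]
    exact hs.2.2.trans_le (hd _ this)

theorem Sl_filter (p M k : ℕ) (m : ZMod f) :
    Finset.filter (Sl p M k m) (Finset.range (M * (p - 1))) =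
    Finset.filter (fun s => ((s / (p - 1) : ℕ) : ZMod f) = m ∧
      s % (p - 1) < dg p k (s / (p - 1))) (Finset.range (M * (p - 1))) := by
  refine Finset.filter_congr fun s hs => ?_
  have : s / (p - 1) < M := Nat.div_lt_of_lt_mul (by rw [mul_comm]; exact Finset.mem_range.mp hs)
  simp [Sl, this]

theorem count_Sl (p M k : ℕ) (hp : 2 ≤ p) (m : ZMod f) :
    Nat.count (Sl p M k m) (M * (p - 1)) = Gm p M k m := by
  have := slot_sum p M k hp m (fun _ => 1)
  simp only [mul_one] at this
  rw [Nat.count_eq_card_filter_range, Sl_filter, Finset.card_eq_sum_ones, this, Gm]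

theorem PP_lt (p M k : ℕ) (hp : 2 ≤ p) (m : ZMod f) (t : ℕ) (ht : t < Gm p M k m) :
    PP p M k m t < M := by
  rw [← count_Sl p M k hp] at ht
  have := Nat.nth_lt_of_lt_count ht
  exact Nat.div_lt_of_lt_mul (by rwa [mul_comm] at this)

theorem cost_zero (p M k : ℕ) (hp : 2 ≤ p) (hk : k < p ^ M) :
    cost p (fun m => (Gm p M k m : ℤ)) (PP p M k) (fun _ : ZMod f => 0) = k := by
  conv_rhs => rw [← sum_cls (f := f) p M k hk]
  unfold cost
  refine Finset.sum_congr rfl fun m _ => ?_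
  rw [← slot_sum p M k hp m (fun i => p ^ i), ← Sl_filter, ← nth_sum_eq, count_Sl p M k hp]
  simp [Vv, nn, PP]

/-- multiplicities of positions -/
def mul' (p : ℕ) (l : ZMod f → ℤ) (P : ZMod f → ℕ → ℕ) (x : ZMod f → ℤ) (i : ℕ) : ℕ :=
  ((Finset.range (nn p l x i).toNat).filter fun t => P i t = i).card

theorem mul'_lt (p : ℕ) (l : ZMod f → ℤ) (P : ZMod f → ℕ → ℕ) (hG : Good p P) (x : ZMod f → ℤ)
    (i : ℕ) : mul' p l P x i < p := by
  have hp := hG.two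
  unfold mul'
  rcases ((Finset.range (nn p l x i).toNat).filter fun t => P i t = i).eq_empty_or_nonempty
    with h | h
  · rw [h]; simp; omega
  obtain ⟨a0, ha0, hmin⟩ := Finset.exists_min_image _ id h
  have hc : ((Finset.range (nn p l x i).toNat).filter fun t => P i t = i) ⊆
      (Finset.Ico a0 (a0 + (p - 1))) := by
    intro a ha
    have h5 : a0 ≤ a := hmin a ha
    have h6 := (Finset.mem_filter.mp ha).2
    have h7 := (Finset.mem_filter.mp ha0).2
    rw [Finset.mem_Ico]
    refine ⟨h5, ?_⟩
    by_contra hc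
    have h9 := hG.mult i a0
    have h10 := hG.mono i (not_lt.mp hc)
    omega
  have := Finset.card_le_card hc
  simp at this
  omega

theorem cost_mul' (p M k : ℕ) (hp : 2 ≤ p) (x : ZMod f → ℤ)
    (hx : ∀ m, nn p (fun m => (Gm p M k m : ℤ)) x m ≤ Gm p M k m) :
    cost p (fun m => (Gm p M k m : ℤ)) (PP p M k) x
      = ∑ i ∈ Finset.range M, mul' p (fun m => (Gm p M k m : ℤ)) (PP p M k) x i * p ^ i := by
  rw [← Finset.sum_fiberwise (s := Finset.range M) (g := fun i : ℕ => (i : ZMod f))]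
  unfold cost
  refine Finset.sum_congr rfl fun m _ => ?_
  unfold Vv
  have hmaps : ∀ t ∈ Finset.range (nn p (fun m => (Gm p M k m : ℤ)) x m).toNat, PP p M k m t ∈
      Finset.filter (fun i : ℕ => (i : ZMod f) = m) (Finset.range M) := by
    intro t ht
    rw [Finset.mem_filter, Finset.mem_range]
    have h1 := hx m
    have h2 := Finset.mem_range.mp ht
    exact ⟨PP_lt p M k hp m t (by omega), PP_cls p M k hp m t⟩
  rw [← Finset.sum_fiberwise_of_maps_to hmaps]
  refine Finset.sum_congr rfl fun i hi => ?_
  have him := (Finset.mem_filter.mp hi).2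
  subst him
  rw [Finset.sum_congr rfl (fun t ht => by rw [(Finset.mem_filter.mp ht).2]), Finset.sum_const,
    smul_eq_mul, mul']
end PS

set_option linter.unusedSectionVars false
namespace PS
variable {f : ℕ} [NeZero f]

def RR (p : ℕ) (l : ZMod f → ℤ) (m : ZMod f) : ℤ := ∑ r ∈ Finset.range f, l (m + r) * p ^ r

theorem tele (p : ℕ) (x : ZMod f → ℤ) (m : ZMod f) :
    RR p (fun m => p * x (m + 1) - x m) m = (p ^ f - 1) * x m := by
  have h : ∀ n : ℕ, ∑ r ∈ Finset.range n, (p * x (m + r + 1) - x (m + r)) * (p : ℤ) ^ r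
      = p ^ n * x (m + n) - x m := by
    intro n
    induction n with
    | zero => simp
    | succ n ih =>
      rw [Finset.sum_range_succ, ih]
      push_cast
      rw [← add_assoc]
      ring
  rw [RR, h f]
  simp
  ring

theorem RR_rec (p : ℕ) (l : ZMod f → ℤ) (m : ZMod f) :
    p * RR p l (m + 1) - RR p l m = (p ^ f - 1) * l m := by
  rw [← tele, RR, RR, RR, Finset.mul_sum, ← Finset.sum_sub_distrib]
  refine Finset.sum_congr rfl fun r _ => ?_
  rw [show m + 1 + (r : ZMod f) = m + r + 1 by ring]
  ring

theorem RR_mono (p : ℕ) (l l' : ZMod f → ℤ) (h : ∀ m, l m ≤ l' m) (m : ZMod f) :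
    RR p l m ≤ RR p l' m :=
  Finset.sum_le_sum fun r _ => mul_le_mul_of_nonneg_right (h _) (by positivity)

theorem RR_Gm (p M j : ℕ) (m : ZMod f) :
    RR p (fun m => (Gm p M j m : ℤ)) m
      = ((∑ i ∈ Finset.range M, dg p j i * p ^ ((i : ZMod f) - m).val : ℕ) : ℤ) := by
  simp only [RR, Gm]
  push_cast
  simp only [Finset.sum_filter, Finset.sum_mul]
  rw [Finset.sum_comm]
  refine Finset.sum_congr rfl fun i _ => ?_
  rw [Finset.sum_eq_single ((i : ZMod f) - m).val]
  · simp
  · intro r hr hne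
    rw [if_neg, zero_mul]
    intro h
    apply hne
    rw [h, add_sub_cancel_left, ZMod.val_natCast, Nat.mod_eq_of_lt (Finset.mem_range.mp hr)]
  · intro h
    exact absurd (Finset.mem_range.mpr (ZMod.val_lt _)) h

theorem RR_modEq (p M j : ℕ) (hj : j < p ^ M) :
    (((p : ℤ) ^ f - 1)) ∣ (j : ℤ) - RR p (fun m : ZMod f => (Gm p M j m : ℤ)) 0 := by
  rw [RR_Gm]
  conv_rhs => rw [← sum_dg p M j hj]
  push_cast
  rw [← Finset.sum_sub_distrib]
  refine Finset.dvd_sum fun i _ => ?_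
  rw [sum_dg p M j hj, ← mul_sub]
  refine Dvd.dvd.mul_left ?_ _
  rw [sub_zero, ZMod.val_natCast]
  conv_rhs => rw [← Nat.mod_add_div i f, pow_add, pow_mul]
  rw [Nat.add_mul_mod_self_left, Nat.mod_mod]
  have := sub_one_dvd_pow_sub_one ((p : ℤ) ^ f) (i / f)
  rw [← mul_sub_one]
  exact this.mul_left _

theorem mul'_sum (p M k : ℕ) (hp : 2 ≤ p) (x : ZMod f → ℤ)
    (hx : Feas p (fun m => (Gm p M k m : ℤ)) x) (m : ZMod f) :
    (∑ i ∈ Finset.range M with ((i : ℕ) : ZMod f) = m,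
      mul' p (fun m => (Gm p M k m : ℤ)) (PP p M k) x i : ℕ)
      = nn p (fun m => (Gm p M k m : ℤ)) x m := by
  have hmaps : ∀ t ∈ Finset.range (nn p (fun m => (Gm p M k m : ℤ)) x m).toNat, PP p M k m t ∈
      Finset.filter (fun i : ℕ => (i : ZMod f) = m) (Finset.range M) := by
    intro t ht
    rw [Finset.mem_filter, Finset.mem_range]
    have h1 : nn p (fun m => (Gm p M k m : ℤ)) x m ≤ Gm p M k m := (hx m).2
    have h2 := Finset.mem_range.mp ht
    exact ⟨PP_lt p M k hp m t (by omega), PP_cls p M k hp m t⟩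
  have h1 := Finset.card_eq_sum_card_fiberwise hmaps
  rw [Finset.card_range] at h1
  have h2 := (hx m).1
  have h3 : ∑ i ∈ Finset.range M with ((i : ℕ) : ZMod f) = m,
      mul' p (fun m => (Gm p M k m : ℤ)) (PP p M k) x i
      = (nn p (fun m => (Gm p M k m : ℤ)) x m).toNat := by
    rw [h1]
    refine Finset.sum_congr rfl fun i hi => ?_
    have him := (Finset.mem_filter.mp hi).2
    subst him
    rfl
  rw [h3]
  omega

theorem cost_dg (p M k : ℕ) (hp : 2 ≤ p) (x : ZMod f → ℤ)
    (hx : Feas p (fun m => (Gm p M k m : ℤ)) x) (i : ℕ) (hi : i < M) :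
    dg p (cost p (fun m => (Gm p M k m : ℤ)) (PP p M k) x) i
      = mul' p (fun m => (Gm p M k m : ℤ)) (PP p M k) x i := by
  rw [cost_mul' p M k hp x fun m => (hx m).2]
  exact dg_sum p (by omega) M _ (mul'_lt p _ _ (good p M k hp) x) i hi

theorem cost_lt (p M k : ℕ) (hp : 2 ≤ p) (x : ZMod f → ℤ)
    (hx : Feas p (fun m => (Gm p M k m : ℤ)) x) :
    cost p (fun m => (Gm p M k m : ℤ)) (PP p M k) x < p ^ M := by
  rw [cost_mul' p M k hp x fun m => (hx m).2]
  exact sum_dg_lt p M _ (mul'_lt p _ _ (good p M k hp) x)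

theorem cost_Gm (p M k : ℕ) (hp : 2 ≤ p) (x : ZMod f → ℤ)
    (hx : Feas p (fun m => (Gm p M k m : ℤ)) x) (m : ZMod f) :
    (Gm p M (cost p (fun m => (Gm p M k m : ℤ)) (PP p M k) x) m : ℤ)
      = nn p (fun m => (Gm p M k m : ℤ)) x m := by
  rw [← mul'_sum p M k hp x hx m, Gm]
  congr 1
  refine Finset.sum_congr rfl fun i hi => ?_
  exact cost_dg p M k hp x hx i (Finset.mem_range.mp (Finset.mem_filter.mp hi).1)

/-- chains of integers -/
def NC (p q : ℕ) : ℕ → List ℕ → Prop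
  | _, [] => True
  | k, j :: js => j < k ∧ (q - 1) ∣ (k - j) ∧ ¬ p ∣ k.choose j ∧ NC p q j js

theorem dvd_conv (p f a b : ℕ) (hp : 2 ≤ p) (h : b ≤ a) :
    (p ^ f - 1) ∣ (a - b) ↔ ((p : ℤ) ^ f - 1) ∣ (a : ℤ) - b := by
  rw [← Int.natCast_dvd_natCast, Nat.cast_sub h, Nat.cast_sub (Nat.one_le_pow _ _ (by omega))]
  push_cast
  rfl

theorem backward (p M k : ℕ) (hp : p.Prime) :
    ∀ (zs : List (ZMod f → ℤ)) (x : ZMod f → ℤ), Feas p (fun m => (Gm p M k m : ℤ)) x →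
      IsCh p (fun m => (Gm p M k m : ℤ)) (fun m => x m + 1) zs →
      MonoN p (fun m => (Gm p M k m : ℤ)) x zs →
      NC p (p ^ f) (cost p (fun m => (Gm p M k m : ℤ)) (PP p M k) x)
        (zs.map (cost p (fun m => (Gm p M k m : ℤ)) (PP p M k))) := by
  have hp2 := hp.two_le
  intro zs
  induction zs with
  | nil => intros; trivial
  | cons z zs ih =>
    intro x hx hch hmono
    obtain ⟨hz, hxz, hzs⟩ := hch
    obtain ⟨hzx, hmono'⟩ := hmono
    have hle : cost p (fun m => (Gm p M k m : ℤ)) (PP p M k) z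
        ≤ cost p (fun m => (Gm p M k m : ℤ)) (PP p M k) x :=
      Finset.sum_le_sum fun m _ => Vv_mono _ _ _ (hzx m)
    have hlt := lt_of_le_of_ne hle fun h => by
      have := cost_inj p _ _ (good p M k hp2) z x hz hx h
      have h2 : x 0 + 1 ≤ z 0 := hxz 0
      rw [this] at h2
      omega
    refine ⟨hlt, ?_, ?_, ih z hz hzs hmono'⟩
    · rw [dvd_conv p f _ _ hp2 hle]
      have e1 := RR_modEq (f := f) p M _ (cost_lt p M k hp2 x hx)
      have e2 := RR_modEq (f := f) p M _ (cost_lt p M k hp2 z hz)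
      have h1 : RR p (fun m : ZMod f => (Gm p M (cost p (fun m : ZMod f => (Gm p M k m : ℤ)) (PP p M k) x) m : ℤ)) 0
          - RR p (fun m : ZMod f => (Gm p M (cost p (fun m : ZMod f => (Gm p M k m : ℤ)) (PP p M k) z) m : ℤ)) 0
          = (p ^ f - 1) * (z 0 - x 0) := by
        simp only [cost_Gm p M k hp2 x hx, cost_Gm p M k hp2 z hz]
        have := tele p (fun m => z m - x m) 0
        rw [← this, RR, RR, RR, ← Finset.sum_sub_distrib]
        refine Finset.sum_congr rfl fun r _ => ?_
        simp only [nn]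
        ring
      obtain ⟨u1, hu1⟩ := e1
      obtain ⟨u2, hu2⟩ := e2
      exact ⟨u1 - u2 + (z 0 - x 0), by linarith⟩
    · rw [lucas_iff p hp M _ _ (cost_lt p M k hp2 x hx) (cost_lt p M k hp2 z hz)]
      intro i hi
      rw [cost_dg p M k hp2 x hx i hi, cost_dg p M k hp2 z hz i hi]
      refine Finset.card_le_card (Finset.filter_subset_filter _ (Finset.range_mono ?_))
      exact Int.toNat_le_toNat (hzx _)

/-- the vector attached to an integer -/
def XX (p M k j : ℕ) (m : ZMod f) : ℤ :=
  (RR p (fun m => (Gm p M k m : ℤ)) m - RR p (fun m => (Gm p M j m : ℤ)) m) / (p ^ f - 1)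

theorem q_pos (p : ℕ) (hp : 2 ≤ p) : (0 : ℤ) < p ^ f - 1 := by
  have : (1 : ℤ) < p ^ f := one_lt_pow₀ (by exact_mod_cast hp) (NeZero.ne f)
  omega

theorem XX_mul (p M k j : ℕ) (hp : 2 ≤ p) (hk : k < p ^ M) (hj : j < p ^ M)
    (hd : ((p : ℤ) ^ f - 1) ∣ (k : ℤ) - j) (m : ZMod f) :
    ((p : ℤ) ^ f - 1) * XX p M k j m
      = RR p (fun m => (Gm p M k m : ℤ)) m - RR p (fun m => (Gm p M j m : ℤ)) m := by
  refine Int.mul_ediv_cancel' ?_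
  revert m
  refine cyc_ind _ 0 ?_ ?_
  · have e1 := RR_modEq (f := f) p M _ hk
    have e2 := RR_modEq (f := f) p M _ hj
    obtain ⟨u1, hu1⟩ := e1
    obtain ⟨u2, hu2⟩ := e2
    obtain ⟨u3, hu3⟩ := hd
    exact ⟨u2 - u1 + u3, by linarith⟩
  · intro m hm
    have h1 := RR_rec p (fun m => (Gm p M k m : ℤ)) m
    have h2 := RR_rec p (fun m => (Gm p M j m : ℤ)) m
    have hc : IsCoprime ((p : ℤ) ^ f - 1) p := by
      refine ⟨-1, p ^ (f - 1), ?_⟩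
      rw [← pow_succ, Nat.sub_add_cancel (Nat.pos_of_ne_zero (NeZero.ne f))]
      ring
    refine hc.dvd_of_dvd_mul_left ?_
    obtain ⟨c, hc⟩ := hm
    refine ⟨c + Gm p M k m - Gm p M j m, ?_⟩
    linarith

theorem XX_nn (p M k j : ℕ) (hp : 2 ≤ p) (hk : k < p ^ M) (hj : j < p ^ M)
    (hd : ((p : ℤ) ^ f - 1) ∣ (k : ℤ) - j) (m : ZMod f) :
    nn p (fun m => (Gm p M k m : ℤ)) (XX p M k j) m = Gm p M j m := by
  have h1 := XX_mul p M k j hp hk hj hd m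
  have h2 := XX_mul p M k j hp hk hj hd (m + 1)
  have h3 := RR_rec p (fun m => (Gm p M k m : ℤ)) m
  have h4 := RR_rec p (fun m => (Gm p M j m : ℤ)) m
  have h5 := (q_pos (f := f) p hp).ne'
  apply mul_left_cancel₀ h5
  simp only [nn]
  have : ((p : ℤ) ^ f - 1) * (Gm p M k m + XX p M k j m - p * XX p M k j (m + 1))
    = ((p : ℤ) ^ f - 1) * Gm p M k m + ((p : ℤ) ^ f - 1) * XX p M k j m
      - p * (((p : ℤ) ^ f - 1) * XX p M k j (m + 1)) := by ring
  rw [this, h1, h2]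
  linarith

theorem Gm_mono (p M j j' : ℕ) (hd : ∀ i < M, dg p j i ≤ dg p j' i) (m : ZMod f) :
    Gm p M j m ≤ Gm p M j' m :=
  Finset.sum_le_sum fun i hi => hd i (Finset.mem_range.mp (Finset.mem_filter.mp hi).1)

theorem XX_step (p M k j j' : ℕ) (hp : 2 ≤ p) (hk : k < p ^ M) (hj : j < p ^ M) (hj' : j' < p ^ M)
    (hd : ((p : ℤ) ^ f - 1) ∣ (k : ℤ) - j) (hd' : ((p : ℤ) ^ f - 1) ∣ (k : ℤ) - j')
    (hlt : j' ≠ j) (hdom : ∀ i < M, dg p j' i ≤ dg p j i) (m : ZMod f) :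
    XX p M k j m + 1 ≤ XX p M k j' m := by
  have e1 := XX_nn p M k j hp hk hj hd
  have e2 := XX_nn p M k j' hp hk hj' hd'
  have hex : ∃ m0 : ZMod f, XX p M k j' m0 - XX p M k j m0 ≠ 0 := by
    by_contra hc
    push Not at hc
    apply hlt
    have heq : XX p M k j' = XX (f := f) p M k j := funext fun m => sub_eq_zero.mp (hc m)
    have h1 : ∀ m : ZMod f, Gm p M j' m = Gm p M j m := fun m => by
      have := e1 m; have h3 := e2 m; rw [heq] at h3; omega
    have h2 : ∑ i ∈ Finset.range M, dg p j' i = ∑ i ∈ Finset.range M, dg p j i := by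
      rw [← Finset.sum_fiberwise (Finset.range M) (fun i : ℕ => (i : ZMod f)),
        ← Finset.sum_fiberwise (Finset.range M) (fun i : ℕ => (i : ZMod f)) (fun i => dg p j i)]
      exact Finset.sum_congr rfl fun m _ => h1 m
    have h3 := (Finset.sum_eq_sum_iff_of_le fun i hi => hdom i (Finset.mem_range.mp hi)).1 h2
    rw [← sum_dg p M j hj, ← sum_dg p M j' hj']
    exact Finset.sum_congr rfl fun i hi => by rw [h3 i hi]
  obtain ⟨m0, hm0⟩ := hex
  have := one_le_of p hp (fun m => XX p M k j' m - XX p M k j m) (fun m => by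
    have h1 := e1 m
    have h2 := e2 m
    have h3 := Gm_mono p M j' j hdom m
    simp only [nn] at h1 h2
    have h4 : (Gm p M j' m : ℤ) ≤ Gm p M j m := by exact_mod_cast h3
    linarith) m0 hm0 m
  have h9 : 1 ≤ XX p M k j' m - XX p M k j m := this
  omega

theorem forward (p M k : ℕ) (hp : p.Prime) (hk : k < p ^ M) :
    ∀ (js : List ℕ) (j0 : ℕ), j0 < p ^ M → (∀ i < M, dg p j0 i ≤ dg p k i) →
      ((p : ℤ) ^ f - 1) ∣ (k : ℤ) - j0 → NC p (p ^ f) j0 js →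
      IsCh p (fun m => (Gm p M k m : ℤ)) (fun m => XX (f := f) p M k j0 m + 1)
        (js.map (XX p M k)) ∧
      ccost p (fun m => (Gm p M k m : ℤ)) (PP p M k) (js.map (XX (f := f) p M k)) ≤ js.sum ∧
      (ccost p (fun m => (Gm p M k m : ℤ)) (PP p M k) (js.map (XX (f := f) p M k)) = js.sum →
        js = (js.map (XX (f := f) p M k)).map (cost p (fun m => (Gm p M k m : ℤ)) (PP p M k))) := by
  have hp2 := hp.two_le
  intro js
  induction js with
  | nil => intros; exact ⟨trivial, by simp [ccost], by simp⟩
  | cons j js ih =>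
    intro j0 hj0 hdom hd hNC
    obtain ⟨n1, n2, n3, n4⟩ := hNC
    have hj := n1.trans hj0
    rw [lucas_iff p hp M _ _ hj0 hj] at n3
    have hdom' : ∀ i < M, dg p j i ≤ dg p k i := fun i hi => (n3 i hi).trans (hdom i hi)
    rw [dvd_conv p f _ _ hp2 n1.le] at n2
    have hd' : ((p : ℤ) ^ f - 1) ∣ (k : ℤ) - j := by
      have := hd.add n2
      rwa [sub_add_sub_cancel] at this
    obtain ⟨a1, a2, a3⟩ := ih j hj hdom' hd' n4
    have hnn := XX_nn (f := f) p M k j hp2 hk hj hd'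
    have hc := cost_le p M k j hp2 hj hdom' (fun m => (Gm p M k m : ℤ)) (XX (f := f) p M k j) hnn
    refine ⟨⟨fun m => ?_, XX_step p M k j0 j hp2 hk hj0 hj hd hd' n1.ne n3, a1⟩, ?_, ?_⟩
    · rw [hnn]
      exact ⟨by positivity, by beta_reduce; exact_mod_cast Gm_mono p M j k hdom' m⟩
    · simp only [ccost, List.map_cons, List.sum_cons] at a2 ⊢
      omega
    · intro h
      simp only [ccost, List.map_cons, List.sum_cons] at a2 a3 h ⊢
      rw [← a3 (by omega)]
      congr 1
      omega
end PS

set_option linter.unusedSectionVars false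
namespace PS

theorem ds_rec (q a : ℕ) (hq : 2 ≤ q) : (Nat.digits q a).sum = a % q + (Nat.digits q (a / q)).sum := by
  rcases Nat.eq_zero_or_pos a with h | h
  · simp [h]
  · rw [Nat.digits_def' (by omega) h, List.sum_cons]

theorem ds_add (q : ℕ) (hq : 2 ≤ q) : ∀ n a b : ℕ, a + b ≤ n →
    (Nat.digits q (a + b)).sum ≤ (Nat.digits q a).sum + (Nat.digits q b).sum := by
  have hone : ∀ n a : ℕ, a ≤ n → (Nat.digits q (a + 1)).sum ≤ (Nat.digits q a).sum + 1 := by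
    intro n
    induction n with
    | zero =>
      intro a ha
      have : a = 0 := by omega
      subst this
      rw [ds_rec q _ hq, Nat.mod_eq_of_lt (by omega), Nat.div_eq_of_lt (by omega)]
      simp
    | succ n ih =>
      intro a ha
      rw [ds_rec q (a + 1) hq, ds_rec q a hq]
      rw [Nat.add_mod, Nat.add_div (by omega), Nat.mod_eq_of_lt (show 1 < q by omega),
        Nat.div_eq_of_lt (show 1 < q by omega)]
      have hlt := Nat.mod_lt a (show 0 < q by omega)
      split_ifs with h
      · have h1 : a % q + 1 = q := by omega
        rw [h1, Nat.mod_self]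
        have : a ≠ 0 := by rintro rfl; simp at h1; omega
        have h2 := ih (a / q) (by have := Nat.div_lt_self (show 0 < a by omega) (show 1 < q by omega); omega)
        simp only [add_zero]
        omega
      · rw [Nat.mod_eq_of_lt (by omega)]
        simp only [add_zero]
        omega
  intro n
  induction n with
  | zero =>
    intro a b h
    have h1 : a = 0 := by omega
    have h2 : b = 0 := by omega
    simp [h1, h2]
  | succ n ih =>
    intro a b h
    rcases Nat.eq_zero_or_pos (a + b) with h0 | h0
    · have h1 : a = 0 := by omega
      have h2 : b = 0 := by omega
      simp [h1, h2]
    have hd := Nat.div_lt_self h0 (show 1 < q by omega)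
    rw [ds_rec q (a + b) hq, ds_rec q a hq, ds_rec q b hq]
    rw [Nat.add_div (by omega)] at hd ⊢
    have h1 := ih (a / q) (b / q) (by split_ifs at hd <;> omega)
    have ha := Nat.mod_lt a (show 0 < q by omega)
    have hb := Nat.mod_lt b (show 0 < q by omega)
    split_ifs with hc
    · have h2 := hone _ (a / q + b / q) le_rfl
      have h3 : (a + b) % q = a % q + b % q - q := by
        rw [Nat.add_mod, Nat.mod_eq_sub_mod hc, Nat.mod_eq_of_lt (by omega)]
      omega
    · have h3 : (a + b) % q = a % q + b % q := by
        rw [Nat.add_mod, Nat.mod_eq_of_lt (by omega)]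
      rw [add_zero]
      omega

theorem ds_mul (q c a : ℕ) (hq : 2 ≤ q) : (Nat.digits q (c * a)).sum ≤ c * (Nat.digits q a).sum := by
  induction c with
  | zero => simp
  | succ c ih =>
    rw [add_mul, add_mul, one_mul, one_mul]
    exact (ds_add q hq _ _ _ le_rfl).trans (by omega)

theorem ds_sum (q : ℕ) (hq : 2 ≤ q) (M : ℕ) (g : ℕ → ℕ) :
    (Nat.digits q (∑ i ∈ Finset.range M, g i)).sum
      ≤ ∑ i ∈ Finset.range M, (Nat.digits q (g i)).sum := by
  induction M with
  | zero => simp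
  | succ M ih =>
    rw [Finset.sum_range_succ, Finset.sum_range_succ]
    exact (ds_add q hq _ _ _ le_rfl).trans (by omega)

theorem ds_pow (p f : ℕ) (hp : 2 ≤ p) (hf : 0 < f) (n : ℕ) :
    (Nat.digits (p ^ f) (p ^ n)).sum = p ^ (n % f) := by
  have hq : 2 ≤ p ^ f := hp.trans (Nat.le_self_pow hf.ne' p)
  have h1 : ∀ s r : ℕ, r < f → (Nat.digits (p ^ f) (p ^ r * (p ^ f) ^ s)).sum = p ^ r := by
    intro s
    induction s with
    | zero =>
      intro r hr
      have : p ^ r < p ^ f := Nat.pow_lt_pow_right (by omega) hr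
      rw [pow_zero, mul_one, ds_rec _ _ hq, Nat.mod_eq_of_lt this, Nat.div_eq_of_lt this]
      simp
    | succ s ih =>
      intro r hr
      rw [ds_rec _ _ hq, pow_succ, ← mul_assoc, Nat.mul_mod_left,
        Nat.mul_div_cancel _ (by omega), ih r hr, zero_add]
  have := h1 (n / f) (n % f) (Nat.mod_lt _ hf)
  rwa [← pow_mul, ← pow_add, Nat.mod_add_div] at this

variable {f : ℕ} [NeZero f]

theorem ds_le_RR (p M k : ℕ) (hp : 2 ≤ p) (hk : k < p ^ M) (m : ZMod f) :
    ((Nat.digits (p ^ f) (k * p ^ (-m).val)).sum : ℤ) ≤ RR p (fun m => (Gm p M k m : ℤ)) m := by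
  have hf : 0 < f := Nat.pos_of_ne_zero (NeZero.ne f)
  have hq : 2 ≤ p ^ f := hp.trans (Nat.le_self_pow hf.ne' p)
  rw [RR_Gm]
  norm_cast
  have h1 : k * p ^ (-m).val = ∑ i ∈ Finset.range M, dg p k i * p ^ (i + (-m).val) := by
    conv_lhs => rw [← sum_dg p M k hk]
    rw [Finset.sum_mul]
    refine Finset.sum_congr rfl fun i _ => ?_
    rw [pow_add, mul_assoc]
  rw [h1]
  refine (ds_sum _ hq _ _).trans (Finset.sum_le_sum fun i _ => (ds_mul _ _ _ hq).trans ?_)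
  rw [ds_pow p f hp hf, ← ZMod.val_natCast]
  refine le_of_eq ?_
  congr 3
  push_cast
  rw [ZMod.natCast_zmod_val, sub_eq_add_neg]

theorem unique_chain (p M k d : ℕ) (hp : p.Prime) (hk : k < p ^ M)
    (hd : ∀ m : ZMod f, (d : ℤ) * (p ^ f - 1) ≤ RR p (fun m => (Gm p M k m : ℤ)) m) :
    ∃ js, NC p (p ^ f) k js ∧ js.length = d ∧ ∀ js', NC p (p ^ f) k js' → js'.length = d →
      js.sum ≤ js'.sum ∧ (js'.sum = js.sum → js' = js) := by
  have hp2 := hp.two_le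
  have hp' : (2 : ℤ) ≤ p := by exact_mod_cast hp2
  have hq := q_pos (f := f) p hp2
  obtain ⟨l, hl⟩ : ∃ l : ZMod f → ℤ, l = fun m => (Gm p M k m : ℤ) := ⟨_, rfl⟩
  have hG := good (f := f) p M k hp2
  obtain ⟨T, hTdef⟩ : ∃ T : ZMod f → ℤ, T = fun m => RR p l m / (p ^ f - 1) := ⟨_, rfl⟩
  have hTn : ∀ m, 0 ≤ nn p l T m := by
    intro m
    have h1 : T (m + 1) * (p ^ f - 1) ≤ RR p l (m + 1) := by
      rw [hTdef]; exact Int.ediv_mul_le _ hq.ne'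
    have h2 := RR_rec p l m
    have h3 : p * T (m + 1) - l m ≤ T m := by
      conv_rhs => rw [hTdef]
      rw [Int.le_ediv_iff_mul_le hq]
      nlinarith
    simp only [nn]
    linarith
  have hT : ∀ x : ZMod f → ℤ, (∀ m, 0 ≤ nn p l x m) → ∀ m, x m ≤ T m := by
    intro x hx m
    rw [hTdef]
    beta_reduce
    rw [Int.le_ediv_iff_mul_le hq, mul_comm, ← tele]
    refine RR_mono p _ _ (fun m => ?_) m
    have := hx m
    simp only [nn] at this
    linarith
  have hTd : ∀ m, (d : ℤ) ≤ T m := by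
    intro m
    rw [hTdef]
    beta_reduce
    rw [Int.le_ediv_iff_mul_le hq, hl]
    exact hd m
  have hl0 : ∀ m, 0 ≤ l m := fun m => by rw [hl]; positivity
  obtain ⟨zs, hmin, hlen⟩ := exists_min p l (PP p M k) (fun _ => 1) d
    (ch_exists p hp2 l T hTn hl0 d (fun _ => 1) (fun _ => by norm_num) (fun _ => by omega)
      (fun m => by have := hTd m; omega))
  have hX0 : XX (f := f) p M k k = fun _ => 0 := by funext m; simp [XX]
  have hF0 : Feas p l (fun _ => 0) := fun m => by simp [nn, hl0 m]
  have hmono : MonoN p l (fun _ => 0) zs := by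
    cases zs with
    | nil => trivial
    | cons z zs =>
      refine ⟨fun m => ?_, min_monoN p l _ hG zs _ z hmin⟩
      have := (hmin.1.1 m).2
      simpa [nn] using this
  have hb := backward p M k hp zs (fun _ => 0) (by rwa [← hl]) (by
    rw [← hl]; exact hmin.1) (by rwa [← hl])
  rw [cost_zero p M k hp2 hk] at hb
  refine ⟨_, hb, by simpa using hlen, fun js' hN hlen' => ?_⟩
  obtain ⟨a1, a2, a3⟩ := forward (f := f) p M k hp hk js' k hk (fun _ _ => le_rfl) (by simp) hN
  rw [hX0, ← hl] at a1
  rw [← hl] at a2 a3 ⊢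
  have a1' : IsCh p l (fun _ => 1) (js'.map (XX p M k)) := by simpa using a1
  have h5 := hmin.2 _ a1' (by simp [hlen, hlen'])
  have h6 : (zs.map (cost p l (PP p M k))).sum = ccost p l (PP p M k) zs := rfl
  rw [h6]
  refine ⟨h5.trans a2, fun h => ?_⟩
  have h7 : ccost p l (PP p M k) (js'.map (XX p M k)) = ccost p l (PP p M k) zs := by omega
  have h8 : MinCh p l (PP p M k) (fun _ => 1) (js'.map (XX p M k)) := by
    refine ⟨a1', fun zs' b1 b2 => ?_⟩
    rw [h7]
    exact hmin.2 zs' b1 (by simpa [hlen, hlen'] using b2)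
  have h9 := min_unique p l _ hG T hTn hT _ _ _ h8 hmin (by simp [hlen, hlen'])
  rw [a3 (by omega), h9]
end PS

namespace PS

theorem sum_pow_field (Fq : Type) [Field Fq] [Fintype Fq] (n : ℕ) :
    (∑ x : Fq, x ^ n) = if 0 < n ∧ (Fintype.card Fq - 1) ∣ n then -1 else 0 := by
  classical
  by_cases hn : n = 0
  · subst hn; simp
  have h := FiniteField.sum_pow_units Fq n
  have h2 : (∑ x : Fq, x ^ n) = ∑ x : Fqˣ, ((x : Fq) ^ n) := by
    symm
    refine Finset.sum_of_injOn (fun u : Fqˣ => (u : Fq)) (fun _ _ _ _ h => Units.ext h)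
      (by intro; simp) ?_ (fun _ _ => rfl)
    intro x _ hx
    have : x = 0 := by
      by_contra h0
      exact hx ⟨Units.mk0 x h0, by simp, rfl⟩
    simp [this, hn]
  rw [h2, h]
  simp [Nat.pos_of_ne_zero hn]

theorem powerSum_zero (Fq : Type) [Field Fq] [Fintype Fq] (k : ℕ) : powerSum Fq 0 k = 1 := by
  simp [powerSum]

theorem powerSum_succ (Fq : Type) [Field Fq] [Fintype Fq] (d k : ℕ) :
    powerSum Fq (d + 1) k = ∑ j ∈ Finset.range (k + 1),
      C ((∑ x : Fq, x ^ (k - j)) * (k.choose j : Fq)) * X ^ j * powerSum Fq d j := by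
  unfold powerSum
  rw [← (Fin.consEquiv (fun _ => Fq)).sum_comp, Fintype.sum_prod_type]
  have : ∀ (x : Fq) (c : Fin d → Fq),
      (X ^ (d + 1) + ∑ i : Fin (d + 1), C ((Fin.consEquiv (fun _ => Fq) (x, c) : Fin (d+1) → Fq) i) * X ^ (i : ℕ)) ^ k
      = ∑ j ∈ Finset.range (k + 1), C (x ^ (k - j)) * (C (k.choose j : Fq) * X ^ j *
        (X ^ d + ∑ i : Fin d, C (c i) * X ^ (i : ℕ)) ^ j) := by
    intro x c
    rw [Fin.sum_univ_succ]
    simp only [Fin.consEquiv_apply, Fin.cons_zero, Fin.cons_succ, Fin.val_zero, pow_zero, mul_one,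
      Fin.val_succ]
    have e : (X ^ (d + 1) + (C x + ∑ i : Fin d, C (c i) * X ^ ((i : ℕ) + 1)) : Fq[X])
        = X * (X ^ d + ∑ i : Fin d, C (c i) * X ^ (i : ℕ)) + C x := by
      rw [mul_add, Finset.mul_sum]
      have : ∀ i : Fin d, (C (c i) * X ^ ((i : ℕ) + 1) : Fq[X]) = X * (C (c i) * X ^ (i : ℕ)) := by
        intro i; ring
      simp only [this]; ring
    rw [e, add_pow]
    refine Finset.sum_congr rfl fun j _ => ?_
    rw [mul_pow, C_pow, C_eq_natCast]; ring
  simp only [this]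
  simp only [Finset.sum_comm (s := (Finset.univ : Finset (Fin d → Fq))) (t := Finset.range (k+1))]
  rw [Finset.sum_comm]
  refine Finset.sum_congr rfl fun j _ => ?_
  simp only [← Finset.mul_sum]
  rw [← Finset.sum_mul, ← map_sum, C_mul]; ring

theorem coeff_succ (Fq : Type) [Field Fq] [Fintype Fq] (d k N : ℕ) :
    (powerSum Fq (d + 1) k).coeff N = ∑ j ∈ Finset.range (k + 1),
      (∑ x : Fq, x ^ (k - j)) * (k.choose j : Fq) *
        (if j ≤ N then (powerSum Fq d j).coeff (N - j) else 0) := by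
  rw [powerSum_succ, finsetSum_coeff]
  refine Finset.sum_congr rfl fun j _ => ?_
  rw [mul_assoc, coeff_C_mul, coeff_X_pow_mul']

theorem coeff_chain (p f : ℕ) (Fq : Type) [Field Fq] [Fintype Fq] [CharP Fq p]
    (hcard : Fintype.card Fq = p ^ f) (d : ℕ) : ∀ k N,
    ((∀ js, NC p (p ^ f) k js → js.length = d → js.sum ≠ N) → (powerSum Fq d k).coeff N = 0) ∧
    (∀ js, NC p (p ^ f) k js → js.length = d → js.sum = N →
      (∀ js', NC p (p ^ f) k js' → js'.length = d → js'.sum = N → js' = js) →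
      (powerSum Fq d k).coeff N ≠ 0) := by
  induction d with
  | zero =>
    intro k N
    rw [powerSum_zero, coeff_one]
    constructor
    · intro h
      have := h [] trivial rfl
      rw [if_neg (by simpa using this.symm)]
    · intro js _ h2 h3 _
      have : js = [] := List.length_eq_zero_iff.mp h2
      subst this
      simp at h3
      simp [← h3]
  | succ d ih =>
    intro k N
    have hterm : ∀ j, (∀ js, NC p (p ^ f) k (j :: js) → js.length = d → j + js.sum ≠ N) →
        (∑ x : Fq, x ^ (k - j)) * (k.choose j : Fq) *
        (if j ≤ N then (powerSum Fq d j).coeff (N - j) else 0) = 0 := by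
      intro j hj
      rw [sum_pow_field, hcard]
      split_ifs with h1 h2
      · by_cases h3 : p ∣ k.choose j
        · rw [(CharP.cast_eq_zero_iff Fq p _).mpr h3]; simp
        · rw [(ih j (N - j)).1, mul_zero]
          intro js h4 h5 h6
          exact hj js ⟨by omega, h1.2, h3, h4⟩ h5 (by omega)
      all_goals simp
    rw [coeff_succ]
    constructor
    · intro h
      refine Finset.sum_eq_zero fun j _ => hterm j fun js h1 h2 h3 => h (j :: js) h1 (by simp [h2]) (by simpa using h3)
    · intro js h1 h2 h3 h4
      match js, h1, h2, h3, h4 with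
      | j :: js, h1, h2, h3, h4 =>
        simp only [List.length_cons, Nat.add_right_cancel_iff] at h2
        rw [List.sum_cons] at h3
        rw [Finset.sum_eq_single j]
        · obtain ⟨a1, a2, a3, a4⟩ := h1
          rw [sum_pow_field, hcard, if_pos ⟨by omega, a2⟩, if_pos (by omega)]
          refine mul_ne_zero (mul_ne_zero (by simp) ?_) ?_
          · rwa [Ne, CharP.cast_eq_zero_iff Fq p]
          · refine (ih j (N - j)).2 js a4 h2 (by omega) fun js' b1 b2 b3 => ?_
            have := h4 (j :: js') ⟨a1, a2, a3, b1⟩ (by simp [b2]) (by rw [List.sum_cons]; omega)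
            simpa using this
        · intro i _ hi
          refine hterm i fun js' b1 b2 b3 => hi ?_
          have := h4 (i :: js') b1 (by simp [b2]) (by rw [List.sum_cons]; omega)
          simp at this
          exact this.1
        · intro h
          exact absurd (Finset.mem_range.mpr (by have := h1.1; omega)) h

theorem trailing_eq (p f : ℕ) (Fq : Type) [Field Fq] [Fintype Fq] [CharP Fq p]
    (hcard : Fintype.card Fq = p ^ f) (d k : ℕ) (js : List ℕ) (h1 : NC p (p ^ f) k js)
    (h2 : js.length = d)
    (h3 : ∀ js', NC p (p ^ f) k js' → js'.length = d →
      js.sum ≤ js'.sum ∧ (js'.sum = js.sum → js' = js)) :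
    (powerSum Fq d k).natTrailingDegree = js.sum := by
  have hne : (powerSum Fq d k).coeff js.sum ≠ 0 :=
    (coeff_chain p f Fq hcard d k js.sum).2 js h1 h2 rfl fun js' a b c => (h3 js' a b).2 c
  apply le_antisymm
  · exact natTrailingDegree_le_of_ne_zero hne
  · refine le_natTrailingDegree (fun h => hne (by rw [h]; simp)) fun m hm => ?_
    refine (coeff_chain p f Fq hcard d k m).1 fun js' a b c => ?_
    have := (h3 js' a b).1
    omega

theorem Lval_RR (p f k d M : ℕ) [NeZero f] (hp : p.Prime) (hf : 0 < f) (hM : k < p ^ M)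
    (h : (d : ℚ) ≤ Lval p f k hf) (m : ZMod f) :
    (d : ℤ) * ((p : ℤ) ^ f - 1) ≤ RR p (fun m => (Gm p M k m : ℤ)) m := by
  refine le_trans ?_ (ds_le_RR p M k hp.two_le hM m)
  have h1 := h.trans (Finset.inf'_le _ (Finset.mem_range.mpr (ZMod.val_lt (-m))))
  have hq : (0 : ℤ) < (p : ℤ) ^ f - 1 := q_pos (f := f) p hp.two_le
  have hq' : (0 : ℚ) < (p : ℚ) ^ f - 1 := by exact_mod_cast hq
  rw [le_div_iff₀ hq'] at h1
  generalize (Nat.digits (p ^ f) (k * p ^ (-m).val)).sum = S at h1 ⊢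
  have h2 : (((d : ℤ) * ((p : ℤ) ^ f - 1) : ℤ) : ℚ) ≤ ((S : ℤ) : ℚ) := by
    push_cast; exact h1
  exact Int.cast_le.mp h2

end PS

/-- with `ν_d(s)` the `t`-adic valuation of `S_d(s)` (`s = -k < 0`),
`ν_d > ν_{d-1}` for `2 ≤ d ≤ ⌊L_{-s}⌋`, and if `L_{-s} ≥ 1` then `ν_1 ≥ ν_0 = 0`. -/
theorem valuation_monotone
    (p f : ℕ) (hp : p.Prime) (hf : 0 < f)
    (Fq : Type) [Field Fq] [Fintype Fq] (hcard : Fintype.card Fq = p ^ f)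
    (k : ℕ) (hk : 0 < k) :
    (∀ d : ℕ, 2 ≤ d → (d : ℚ) ≤ Lval p f k hf →
      (powerSum Fq (d - 1) k).natTrailingDegree < (powerSum Fq d k).natTrailingDegree) ∧
    ((1 : ℚ) ≤ Lval p f k hf →
      (powerSum Fq 0 k).natTrailingDegree = 0 ∧
      (powerSum Fq 0 k).natTrailingDegree ≤ (powerSum Fq 1 k).natTrailingDegree) := by
  have : NeZero f := ⟨hf.ne'⟩
  have : Fact p.Prime := ⟨hp⟩
  have : CharP Fq p := charP_of_card_eq_prime_pow hcard
  constructor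
  · intro d hd hL
    have hM : k < p ^ k := Nat.lt_pow_self hp.one_lt
    have hL' : ((d - 1 : ℕ) : ℚ) ≤ Lval p f k hf :=
      le_trans (by exact_mod_cast Nat.sub_le d 1) hL
    obtain ⟨js, h1, h2, h3⟩ := PS.unique_chain (f := f) p k k d hp hM
      (PS.Lval_RR p f k d k hp hf hM hL)
    obtain ⟨is, g1, g2, g3⟩ := PS.unique_chain (f := f) p k k (d - 1) hp hM
      (PS.Lval_RR p f k (d - 1) k hp hf hM hL')
    rw [PS.trailing_eq p f Fq hcard d k js h1 h2 h3,
      PS.trailing_eq p f Fq hcard (d - 1) k is g1 g2 g3]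
    match js, h1, h2 with
    | [], _, h2 => simp at h2; omega
    | [_], _, h2 => simp at h2; omega
    | a :: b :: js, h1, h2 =>
      obtain ⟨a1, a2, a3, b1, b2, b3, b4⟩ := h1
      have hn : PS.NC p (p ^ f) k (b :: js) := by
        refine ⟨by omega, ?_, ?_, b4⟩
        · have : k - b = (k - a) + (a - b) := by omega
          rw [this]; exact dvd_add a2 b2
        · intro hb
          have := Nat.choose_mul (n := k) (k := a) (s := b) b1.le
          have h5 : p ∣ k.choose a * a.choose b := this ▸ hb.mul_right _
          rcases hp.dvd_mul.mp h5 with h | h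
          · exact a3 h
          · exact b3 h
      have := (g3 _ hn (by simp at h2 ⊢; omega)).1
      simp only [List.sum_cons] at this ⊢
      omega
  · intro _
    rw [PS.powerSum_zero]
    simp
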